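/- Let T be a colimit-preserving monad on a combinatorial category K. Then the category Alg(T) of T-algebras, with cofibrations defined as those algebra morphisms f such that Uf is a cofibration in K (U the forgetful functor), is a combinatorial category: Alg(T) is locally presentable, U preserves colimits, and the class {f : Uf ∈ cof(K)} is cofibrantly generated by a set. -/

import Mathlib

open CategoryTheory Category Limits Opposite

universe w v u u' u''

namespace CellularPaper

variable {K : Type u} [Category.{v} K]

/-- The restriction of a chain `F : J ⥤ K` to the elements below `j`. -/
def restrictionLT {J : Type w} [Preorder J] (F : J ⥤ K) (j : J) :
    {i : J // i < j} ⥤ K :=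
  (Monotone.functor (f := fun i : {i : J // i < j} => (i : J)) fun _ _ h => h) ⋙ F

/-- The cocone on the restriction of `F` below `j` with apex `F.obj j`. -/
@[simps]
def coconeLT {J : Type w} [Preorder J] (F : J ⥤ K) (j : J) :
    Cocone (restrictionLT F j) where
  pt := F.obj j
  ι :=
    { app := fun i => F.map (homOfLE i.2.le)
      naturality := fun i i' h => by
        dsimp [restrictionLT, Monotone.functor]
        rw [← F.map_comp]
        simp }

/-- `f` is a transfinite composite of a smooth chain with links in `C`. -/
def IsTransfiniteCompositionOf (C : MorphismProperty K) : MorphismProperty K :=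
  fun A B f =>
    ∃ (J : Type w) (_ : LinearOrder J) (_ : SuccOrder J) (_ : OrderBot J)
      (_ : WellFoundedLT J) (F : J ⥤ K) (c : Cocone F) (_ : IsColimit c)
      (eA : A ≅ F.obj ⊥) (eB : c.pt ≅ B),
      (∀ j : J, ¬IsMax j → C (F.map (homOfLE (Order.le_succ j)))) ∧
      (∀ j : J, Order.IsSuccLimit j → Nonempty (IsColimit (coconeLT F j))) ∧
      eA.hom ≫ c.ι.app ⊥ ≫ eB.hom = f

/-- A cellular structure: a class of morphisms containing all isomorphisms and closed
under pushout and transfinite composition. -/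
structure IsCellular (C : MorphismProperty K) : Prop where
  isos : ∀ {A B : K} (f : A ⟶ B), IsIso f → C f
  pushout : ∀ {A B A' B' : K} {f : A ⟶ B} {u : A ⟶ A'} {v : B ⟶ B'} {g : A' ⟶ B'},
    IsPushout f u v g → C f → C g
  transfinite : ∀ {A B : K} (f : A ⟶ B), IsTransfiniteCompositionOf.{v} C f → C f

/-- `f` is a retract of `g` in the arrow category. -/
def IsRetractOf {A B X Y : K} (f : A ⟶ B) (g : X ⟶ Y) : Prop :=
  ∃ (u : A ⟶ X) (v : B ⟶ Y) (r : X ⟶ A) (s : Y ⟶ B),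
    u ≫ g = f ≫ v ∧ r ≫ f = g ≫ s ∧ u ≫ r = 𝟙 A ∧ v ≫ s = 𝟙 B

/-- The class of retracts of morphisms in `C`. -/
def retracts (C : MorphismProperty K) : MorphismProperty K :=
  fun _ _ f => ∃ (X Y : K) (g : X ⟶ Y), C g ∧ IsRetractOf f g

/-- The class of pushouts of morphisms in `C`. -/
def Po (C : MorphismProperty K) : MorphismProperty K :=
  fun A' B' g => ∃ (A B : K) (f : A ⟶ B) (u : A ⟶ A') (v : B ⟶ B'),
    C f ∧ IsPushout f u v g

/-- A κ-directed preorder. -/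
def IsCardinalDirected (P : Type v) [Preorder P] (κ : Cardinal.{v}) : Prop :=
  ∀ S : Set P, Cardinal.mk S < κ → ∃ p : P, ∀ s ∈ S, s ≤ p

/-- A κ-presentable object: its hom-functor preserves κ-directed colimits. -/
def IsCardinalPresentable (κ : Cardinal.{v}) (A : K) : Prop :=
  ∀ (P : Type v) (_ : Preorder P), IsCardinalDirected P κ →
    Nonempty (PreservesColimitsOfShape P (coyoneda.obj (op A)))

/-- A locally κ-presentable category. -/
structure IsLocallyPresentable (κ : Cardinal.{v}) (K : Type u) [Category.{v} K] : Prop where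
  regular : κ.IsRegular
  hasColimits : HasColimits K
  generators : ∃ (ι : Type v) (G : ι → K), (∀ i, IsCardinalPresentable κ (G i)) ∧
    ∀ X : K, ∃ (P : Type v) (_ : Preorder P) (F : P ⥤ K) (c : Cocone F) (_ : IsColimit c),
      IsCardinalDirected P κ ∧ Nonempty (c.pt ≅ X) ∧ ∀ p : P, ∃ i, Nonempty (F.obj p ≅ G i)

/-- A locally presentable category. -/
def LocallyPresentable (K : Type u) [Category.{v} K] : Prop :=
  ∃ κ : Cardinal.{v}, IsLocallyPresentable κ K

/-- The smallest cellular class containing `X`. -/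
def cellClosure (X : MorphismProperty K) : MorphismProperty K :=
  fun _ _ f => ∀ C : MorphismProperty K, IsCellular C → X ≤ C → C f

/-- `cof(X)`: retracts of transfinite composites of pushouts of `X`. -/
def cofClosure (X : MorphismProperty K) : MorphismProperty K :=
  retracts (IsTransfiniteCompositionOf.{v} (Po X))

/-- The morphism property generated by a family of morphisms. -/
def ofFamily {ι : Type*} {a b : ι → K} (s : ∀ i, a i ⟶ b i) : MorphismProperty K :=
  fun _ _ f => ∃ i, Nonempty (Arrow.mk f ≅ Arrow.mk (s i))

/-- `C` is cofibrantly generated by a set of morphisms. -/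
def IsCofibrantlyGenerated (C : MorphismProperty K) : Prop :=
  ∃ (ι : Type v) (a b : ι → K) (s : ∀ i, a i ⟶ b i),
    C = cofClosure (ofFamily s)

/-- A combinatorial structure on a locally presentable category. -/
structure IsCombinatorial (K : Type u) [Category.{v} K] (C : MorphismProperty K) : Prop where
  locallyPresentable : LocallyPresentable K
  cellular : IsCellular C
  retractClosed : retracts C ≤ C
  cofibrantlyGenerated : IsCofibrantlyGenerated C

/-- `f` is a transfinite composite of length `< κ` of morphisms in `C`. -/
def IsBoundedTransfiniteCompositionOf (κ : Cardinal.{v}) (C : MorphismProperty K) :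
    MorphismProperty K :=
  fun A B f =>
    ∃ (J : Type v) (_ : LinearOrder J) (_ : SuccOrder J) (_ : OrderBot J)
      (_ : WellFoundedLT J), Cardinal.mk J < κ ∧
      ∃ (F : J ⥤ K) (c : Cocone F) (_ : IsColimit c)
        (eA : A ≅ F.obj ⊥) (eB : c.pt ≅ B),
        (∀ j : J, ¬IsMax j → C (F.map (homOfLE (Order.le_succ j)))) ∧
        (∀ j : J, Order.IsSuccLimit j → Nonempty (IsColimit (coconeLT F j))) ∧
        eA.hom ≫ c.ι.app ⊥ ≫ eB.hom = f

/-- The morphisms of `C` with κ-presentable domain and codomain. -/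
def betweenPresentable (κ : Cardinal.{v}) (C : MorphismProperty K) : MorphismProperty K :=
  fun A B f => C f ∧ IsCardinalPresentable κ A ∧ IsCardinalPresentable κ B

/-- `Po_κ(X)`: pushouts of morphisms of `X` between κ-presentable objects. -/
def PoCard (κ : Cardinal.{v}) (X : MorphismProperty K) : MorphismProperty K :=
  betweenPresentable κ (Po X)

/-- The category `psh(K²)`: objects are morphisms of `K`, morphisms are pushout squares. -/
structure PshArrow (K : Type u) [Category.{v} K] : Type max u v where
  arr : Arrow K

instance : Category.{v} (PshArrow K) where
  Hom g f := {φ : g.arr ⟶ f.arr // IsPushout g.arr.hom φ.left φ.right f.arr.hom}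
  id g := ⟨𝟙 _, IsPushout.of_vert_isIso ⟨by simp⟩⟩
  comp φ ψ := ⟨φ.1 ≫ ψ.1, φ.2.paste_vert ψ.2⟩
  id_comp φ := Subtype.ext (Category.id_comp _)
  comp_id φ := Subtype.ext (Category.comp_id _)
  assoc _ _ _ := Subtype.ext (Category.assoc _ _ _)


section PsPull

variable {K : Type u} {L : Type u'} {M : Type u''}
variable [Category.{v} K] [Category.{v} L] [Category.{v} M]

/-- The pseudopullback of `F : K ⥤ M` and `G : L ⥤ M`. -/
structure PsPull (F : K ⥤ M) (G : L ⥤ M) : Type max u u' v where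
  k : K
  l : L
  t : F.obj k ≅ G.obj l

variable {F : K ⥤ M} {G : L ⥤ M}

/-- Morphisms in the pseudopullback. -/
@[ext]
structure PsHom (a b : PsPull F G) : Type v where
  hk : a.k ⟶ b.k
  hl : a.l ⟶ b.l
  w : F.map hk ≫ b.t.hom = a.t.hom ≫ G.map hl

instance : Category.{v} (PsPull F G) where
  Hom := PsHom
  id a := ⟨𝟙 _, 𝟙 _, by simp⟩
  comp f g := ⟨f.hk ≫ g.hk, f.hl ≫ g.hl, by
    rw [F.map_comp, G.map_comp, Category.assoc, g.w, ← Category.assoc, f.w,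
      Category.assoc]⟩

/-- The first projection of the pseudopullback. -/
def projK (F : K ⥤ M) (G : L ⥤ M) : PsPull F G ⥤ K where
  obj a := a.k
  map f := f.hk

/-- The second projection of the pseudopullback. -/
def projL (F : K ⥤ M) (G : L ⥤ M) : PsPull F G ⥤ L where
  obj a := a.l
  map f := f.hl

/-- `Ps(C, D)`: morphisms of the pseudopullback whose projections lie in `C` and `D`. -/
def PsClass (C : MorphismProperty K) (D : MorphismProperty L) :
    MorphismProperty (PsPull F G) :=
  fun _ _ f => C f.hk ∧ D f.hl

end PsPull

end CellularPaper

namespace CellularAlgebras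

section WithTopFunctor

variable {J : Type w} [Preorder J] {K : Type u} [Category.{v} K]

/-- The action on morphisms of the extension of a functor to `WithTop`. -/
def withTopMap (F : J ⥤ K) (c : Cocone F) : ∀ x y : WithTop J, x ≤ y →
    (WithTop.recTopCoe (C := fun _ => K) c.pt F.obj x ⟶
      WithTop.recTopCoe (C := fun _ => K) c.pt F.obj y)
  | some a, some b, h => F.map (homOfLE (WithTop.coe_le_coe.1 h))
  | some a, none, _ => c.ι.app a
  | none, none, _ => 𝟙 c.pt
  | none, some b, h => absurd h (by exact WithTop.not_top_le_coe b)

/-- The extension of `F : J ⥤ K` to `WithTop J` sending the top element to the point of a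
cocone. -/
def withTopFunctor (F : J ⥤ K) (c : Cocone F) : WithTop J ⥤ K where
  obj x := WithTop.recTopCoe (C := fun _ => K) c.pt F.obj x
  map {x y} f := withTopMap F c x y (leOfHom f)
  map_id x := by
    cases x with
    | top => rfl
    | coe a => exact F.map_id a
  map_comp {x y z} f g := by
    have hf := leOfHom f
    have hg := leOfHom g
    revert hf hg
    cases x with
    | top =>
      cases y with
      | top =>
        cases z with
        | top => intro _ _; exact (id_comp _).symm
        | coe c => intro _ h; exact absurd h (WithTop.not_top_le_coe c)
      | coe b => intro h; exact absurd h (WithTop.not_top_le_coe b)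
    | coe a =>
      cases y with
      | top =>
        cases z with
        | top => intro _ _; exact (comp_id _).symm
        | coe c => intro _ h; exact absurd h (WithTop.not_top_le_coe c)
      | coe b =>
        cases z with
        | top => intro h _; exact (c.w (homOfLE (WithTop.coe_le_coe.1 h))).symm
        | coe d => intro _ _; exact F.map_comp _ _

/-- The inclusion of `J` in `WithTop J`. -/
def withTopIncl (J : Type w) [Preorder J] : J ⥤ WithTop J :=
  Monotone.functor (f := ((↑) : J → WithTop J)) fun _ _ h => WithTop.coe_le_coe.2 h

lemma hasColimitsOfShape_withTop {J : Type w} [LinearOrder J] [WellFoundedLT J]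
    (D : Type u') [Category.{u''} D] : HasColimitsOfShape D (WithTop J) where
  has_colimit q := by
    obtain ⟨m, hm, hmin⟩ := WellFounded.has_min (wellFounded_lt (α := WithTop J))
      {x | ∀ d, q.obj d ≤ x} ⟨⊤, fun _ => le_top⟩
    exact ⟨⟨⟨{ pt := m, ι := { app := fun d => homOfLE (hm d) } },
      { desc := fun s => homOfLE (not_lt.1 (hmin s.pt fun d => leOfHom (s.ι.app d))) }⟩⟩⟩

end WithTopFunctor

section Cells

variable {R : Type v} [Preorder R] {K : Type u} [Category.{v} K] [HasColimitsOfSize.{v, v} K]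
variable {J : Type v} (c : J → R)

/-- The functor `R ⥤ K` obtained by freely adding a copy of `D j` in degrees above `c j`. -/
noncomputable def cells (D : J → K) : R ⥤ K where
  obj r := ∐ fun j : {j // c j ≤ r} => D j
  map {r r'} f := Sigma.desc fun j =>
    Sigma.ι (fun j : {j // c j ≤ r'} => D j) ⟨j, j.2.trans (leOfHom f)⟩
  map_id r := by
    apply Sigma.hom_ext
    simp
  map_comp f g := by
    apply Sigma.hom_ext
    simp

variable {c}

/-- The inclusion of a cell. -/
noncomputable def cellι (D : J → K) {r : R} (j : J) (h : c j ≤ r) : D j ⟶ (cells c D).obj r :=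
  Sigma.ι (fun j : {j // c j ≤ r} => D j) ⟨j, h⟩

@[simp]
lemma cellι_map (D : J → K) {r r' : R} (j : J) (h : c j ≤ r) (f : r ⟶ r') :
    cellι D j h ≫ (cells c D).map f = cellι D j (h.trans (leOfHom f)) := by
  simp [cellι, cells]

@[simp]
lemma cellι_map_assoc (D : J → K) {r r' : R} (j : J) (h : c j ≤ r) (f : r ⟶ r') {Z : K}
    (g : (cells c D).obj r' ⟶ Z) :
    cellι D j h ≫ (cells c D).map f ≫ g = cellι D j (h.trans (leOfHom f)) ≫ g := by
  rw [← assoc, cellι_map]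

lemma cells_hom_ext {D : J → K} {r : R} {M : K} {f g : (cells c D).obj r ⟶ M}
    (h : ∀ j (hj : c j ≤ r), cellι D j hj ≫ f = cellι D j hj ≫ g) : f = g :=
  Sigma.hom_ext _ _ fun j => h j.1 j.2

/-- Morphisms out of the value of `cells`. -/
noncomputable def cellsObjDesc {D : J → K} {r : R} {M : K} (a : ∀ j, c j ≤ r → (D j ⟶ M)) :
    (cells c D).obj r ⟶ M :=
  Sigma.desc fun j => a j.1 j.2

@[simp]
lemma cellι_objDesc {D : J → K} {r : R} {M : K} (a : ∀ j, c j ≤ r → (D j ⟶ M)) (j : J)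
    (h : c j ≤ r) : cellι D j h ≫ cellsObjDesc a = a j h :=
  Sigma.ι_desc (f := fun j : {j // c j ≤ r} => D j) _ ⟨j, h⟩

@[simp]
lemma cellι_objDesc_assoc {D : J → K} {r : R} {M : K} (a : ∀ j, c j ≤ r → (D j ⟶ M)) (j : J)
    (h : c j ≤ r) {Z : K} (g : M ⟶ Z) : cellι D j h ≫ cellsObjDesc a ≫ g = a j h ≫ g := by
  rw [← assoc, cellι_objDesc]

/-- The functoriality of `cells`. -/
noncomputable def cellsMap {D E : J → K} (x : ∀ j, D j ⟶ E j) : cells c D ⟶ cells c E where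
  app r := cellsObjDesc fun j h => x j ≫ cellι E j h
  naturality r r' f := cells_hom_ext fun j hj => by simp

@[simp]
lemma cellι_cellsMap_app {D E : J → K} (x : ∀ j, D j ⟶ E j) {r : R} (j : J) (h : c j ≤ r) :
    cellι D j h ≫ (cellsMap x).app r = x j ≫ cellι E j h := by
  simp [cellsMap]

@[simp]
lemma cellι_cellsMap_app_assoc {D E : J → K} (x : ∀ j, D j ⟶ E j) {r : R} (j : J) (h : c j ≤ r)
    {Z : K} (g : (cells c E).obj r ⟶ Z) :
    cellι D j h ≫ (cellsMap x).app r ≫ g = x j ≫ cellι E j h ≫ g := by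
  rw [← assoc, cellι_cellsMap_app, assoc]

/-- Morphisms out of `cells`. -/
noncomputable def cellsDesc {D : J → K} {F : R ⥤ K} (a : ∀ j, D j ⟶ F.obj (c j)) :
    cells c D ⟶ F where
  app r := cellsObjDesc fun j h => a j ≫ F.map (homOfLE h)
  naturality r r' f := cells_hom_ext fun j hj => by
    rw [cellι_map_assoc, cellι_objDesc, cellι_objDesc_assoc, assoc, ← F.map_comp]
    rfl

@[simp]
lemma cellι_cellsDesc_app {D : J → K} {F : R ⥤ K} (a : ∀ j, D j ⟶ F.obj (c j)) {r : R} (j : J)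
    (h : c j ≤ r) : cellι D j h ≫ (cellsDesc a).app r = a j ≫ F.map (homOfLE h) := by
  simp [cellsDesc]

/-- `cells` sends a cocone to a colimit cocone, under conditions on the labels. -/
lemma nonempty_isColimit_cells (D : J → K) {𝒟 : Type u'} [Category.{u''} 𝒟] [IsFiltered 𝒟]
    (q : 𝒟 ⥤ R) (s : Cocone q) (h : ∀ j, c j ≤ s.pt → ∃ d, c j ≤ q.obj d) :
    Nonempty (IsColimit ((cells c D).mapCocone s)) := by
  have := IsFiltered.nonempty (C := 𝒟)
  choose! d hd using h
  refine ⟨{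
    desc := fun t => cellsObjDesc fun j hj => cellι D j (hd j hj) ≫ t.ι.app (d j)
    fac := fun t e => cells_hom_ext fun j hj => ?_
    uniq := fun t m hm => cells_hom_ext fun j hj => ?_ }⟩
  · have hj' : c j ≤ s.pt := hj.trans (leOfHom (s.ι.app e))
    dsimp
    rw [cellι_map_assoc, cellι_objDesc]
    rw [← t.w (IsFiltered.leftToMax (d j) e), ← t.w (IsFiltered.rightToMax (d j) e)]
    simp
  · have := hm (d j)
    dsimp at this
    simp [← this]

end Cells

end CellularAlgebras

namespace CellularAlgebras

section

variable {K : Type u} [Category.{v} K] [HasColimitsOfSize.{v, v} K]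

lemma exists_of_pushouts_coproducts {X : MorphismProperty K} {S S' : K} {g : S ⟶ S'}
    (hg : (MorphismProperty.coproducts.{v} X).pushouts g) :
    ∃ (N : Type v) (D E : N → K) (x : ∀ j, D j ⟶ E j) (a : ∀ j, D j ⟶ S) (b : ∀ j, E j ⟶ S'),
      (∀ j, X (x j)) ∧ IsPushout (Sigma.desc a) (Limits.Sigma.map x) g (Sigma.desc b) := by
  obtain ⟨P, Q, f, u, v, hf, sq⟩ := hg
  rw [MorphismProperty.coproducts_iff] at hf
  obtain ⟨N, hf⟩ := hf
  obtain ⟨D, E, c₁, c₂, h₁, h₂, y, hy⟩ := hf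
  let e {Z : Discrete N ⥤ K} {c : Cocone Z} (h : IsColimit c) :
      c.pt ≅ ∐ fun j => Z.obj ⟨j⟩ :=
    { hom := h.desc ⟨_, Discrete.natTrans fun j => Sigma.ι (fun j => Z.obj ⟨j⟩) j.as⟩
      inv := Sigma.desc fun j => c.ι.app ⟨j⟩
      hom_inv_id := h.hom_ext fun j => by simp
      inv_hom_id := Sigma.hom_ext _ _ fun j => by simp }
  refine ⟨N, fun j => D.obj ⟨j⟩, fun j => E.obj ⟨j⟩, fun j => y.app ⟨j⟩,
    fun j => c₁.ι.app ⟨j⟩ ≫ u, fun j => c₂.ι.app ⟨j⟩ ≫ v, fun j => hy _, ?_⟩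
  refine sq.of_iso (e h₁) (Iso.refl _) (e h₂) (Iso.refl _) ?_ ?_ ?_ ?_
  · exact h₁.hom_ext fun j => by simp [e]
  · exact h₁.hom_ext fun j => by simp [e]
  · simp
  · exact h₂.hom_ext fun j => by simp [e]

variable {R : Type v} [Preorder R] [OrderTop R]

lemma exists_attach {F : R ⥤ K} {S S' : K} {g : S ⟶ S'} (φ : F.obj ⊤ ≅ S) {N : Type v}
    {D E : N → K} {x : ∀ j, D j ⟶ E j} {a : ∀ j, D j ⟶ S} {b : ∀ j, E j ⟶ S'}
    (sq : IsPushout (Sigma.desc a) (Limits.Sigma.map x) g (Sigma.desc b))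
    {c : N → R} (a' : ∀ j, D j ⟶ F.obj (c j))
    (ha' : ∀ j, a' j ≫ F.map (homOfLE le_top) ≫ φ.hom = a j) :
    ∃ (G : R ⥤ K) (f : F ⟶ G) (b' : cells c E ⟶ G) (ψ : G.obj ⊤ ≅ S'),
      IsPushout (cellsDesc a') (cellsMap x) f b' ∧ f.app ⊤ ≫ ψ.hom = φ.hom ≫ g := by
  have h₁ := IsPushout.of_hasPushout (cellsDesc a') (cellsMap (c := c) x)
  have h₂ := h₁.map ((evaluation R K).obj ⊤)
  let e (D : N → K) : (cells c D).obj ⊤ ≅ ∐ D :=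
    { hom := cellsObjDesc fun j _ => Sigma.ι D j
      inv := Sigma.desc fun j => cellι D j le_top
      hom_inv_id := cells_hom_ext fun j hj => by simp
      inv_hom_id := Sigma.hom_ext _ _ fun j => by simp }
  have h₃ : IsPushout ((cellsDesc a').app ⊤) ((cellsMap (c := c) x).app ⊤) (φ.hom ≫ g)
      ((e E).hom ≫ Sigma.desc b) := by
    refine sq.of_iso (e D).symm φ.symm (e E).symm (Iso.refl _) ?_ ?_ ?_ ?_
    · refine Sigma.hom_ext _ _ fun j => ?_
      simp [e, ← ha']
    · refine Sigma.hom_ext _ _ fun j => ?_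
      simp [e]
    · simp
    · simp
  exact ⟨_, _, _, h₂.isoIsPushout _ _ h₃, h₁, h₂.inl_isoIsPushout_hom _ _ h₃⟩

end

end CellularAlgebras

namespace CellularAlgebras

section

variable {K : Type u} [Category.{v} K]

lemma isIso_hom_of_isColimit {A B : Type*} [Category A] [Category B] {L : A ⥤ K} {P : B ⥤ K}
    {𝒟 : Type*} [Category 𝒟] {q : 𝒟 ⥤ Comma L P} {s : Cocone q}
    (h₁ : IsColimit ((Comma.fst L P ⋙ L).mapCocone s))
    (h₂ : IsColimit ((Comma.snd L P ⋙ P).mapCocone s))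
    (h : ∀ d, IsIso (q.obj d).hom) : IsIso s.pt.hom := by
  let e : q ⋙ Comma.fst L P ⋙ L ≅ q ⋙ Comma.snd L P ⋙ P :=
    NatIso.ofComponents (fun d => asIso (q.obj d).hom)
  have : s.pt.hom = (h₁.coconePointsIsoOfNatIso h₂ e).hom :=
    h₁.hom_ext fun d => by
      rw [IsColimit.comp_coconePointsIsoOfNatIso_hom]
      simp [e]
  rw [this]
  infer_instance

/-- A well-ordered chain extended by its colimit. -/
noncomputable abbrev extendedChain {J₀ : Type v} [LinearOrder J₀] [OrderBot J₀] [SuccOrder J₀]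
    [WellFoundedLT J₀] {A B : K} {i : A ⟶ B} (E : TransfiniteCompositionOfShape J₀ i) :
    WithTop J₀ ⥤ K :=
  withTopFunctor E.F (Cocone.mk B E.incl)

variable {J₀ : Type v} [LinearOrder J₀] [OrderBot J₀] [SuccOrder J₀]
    [WellFoundedLT J₀] {A B : K} {i : A ⟶ B} (E : TransfiniteCompositionOfShape J₀ i)

lemma nonempty_isColimit_extendedChain {𝒟 : Type*} [Preorder 𝒟] {q : 𝒟 ⥤ WithTop J₀}
    (s : Cocone q) (F : 𝒟 → J₀) (hF : Monotone F) (hq : ∀ d, q.obj d = F d)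
    (c : Cocone (hF.functor ⋙ E.F)) (hc : IsColimit c)
    (e : c.pt ≅ (extendedChain E).obj s.pt)
    (he : ∀ d, c.ι.app d ≫ e.hom =
      (extendedChain E).map ((eqToHom (hq d).symm) ≫ s.ι.app d)) :
    Nonempty (IsColimit ((extendedChain E).mapCocone s)) := by
  let ν : hF.functor ⋙ E.F ≅ q ⋙ extendedChain E :=
    NatIso.ofComponents (fun d => (extendedChain E).mapIso (eqToIso (hq d).symm)) (by
      intro d d' f
      have : (hF.functor ⋙ E.F).map f = (extendedChain E).map
        (homOfLE (WithTop.coe_le_coe.2 (hF (leOfHom f))) : (F d : WithTop J₀) ⟶ F d') := rfl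
      rw [this]
      simp only [Functor.comp_map, Functor.mapIso_hom]
      erw [← (extendedChain E).map_comp, ← (extendedChain E).map_comp]
      rfl)
  refine ⟨(IsColimit.precomposeHomEquiv ν _).1 (hc.ofIsoColimit (Cocone.ext e ?_))⟩
  intro d
  rw [he, Functor.map_comp]
  rfl

lemma isLUB_of_isColimit {Q : Type*} [Preorder Q] {𝒟 : Type*} [Category 𝒟] {q : 𝒟 ⥤ Q}
    {s : Cocone q} (h : IsColimit s) {m : Q} (hm : ∀ d, q.obj d ≤ m) : s.pt ≤ m :=
  leOfHom (h.desc { pt := m, ι := { app := fun d => homOfLE (hm d) } })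

end

end CellularAlgebras

namespace CellularAlgebras

open SmallObject

section

variable {K : Type u} [Category.{v} K] [HasColimitsOfSize.{v, v} K]
variable {R : Type v} [Preorder R]

/-- Attaching cells indexed by part of a family. -/
def attachCells {J : Type v} (c : J → R) {D E : J → K} (x : ∀ j, D j ⟶ E j) :
    MorphismProperty (R ⥤ K) := fun F G f =>
  ∃ (M : Type v) (m : M → J) (_ : m.Injective) (a : cells (c ∘ m) (D ∘ m) ⟶ F)
    (b : cells (c ∘ m) (E ∘ m) ⟶ G), IsPushout a (cellsMap fun j => x (m j)) f b

variable [OrderTop R]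
  {J₀ : Type v} [LinearOrder J₀] [OrderBot J₀] [SuccOrder J₀]
    [WellFoundedLT J₀] {A B : K} {i : A ⟶ B} (E : TransfiniteCompositionOfShape J₀ i)

abbrev ChainLift := Comma ((evaluation R K).obj ⊤) (extendedChain E)

structure ChainLift.IsGood (Acc : ObjectProperty (R ⥤ K)) (n : J₀) (Y : ChainLift (R := R) E) :
    Prop where
  right : Y.right = n
  isIso : IsIso Y.hom
  acc : Acc Y.left

theorem exists_chainLift_succ (Acc : ObjectProperty (R ⥤ K)) (n : J₀) (Y : ChainLift (R := R) E)
    (hY : Y.IsGood E Acc n) {N : Type v} {S T : N → K} (x : ∀ j, S j ⟶ T j)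
    (good : N → R → Prop)
    {a : ∀ j, S j ⟶ E.F.obj n} {b : ∀ j, T j ⟶ E.F.obj (Order.succ n)}
    (sq : IsPushout (Sigma.desc a) (Limits.Sigma.map x) (E.F.map (homOfLE (Order.le_succ n)))
      (Sigma.desc b))
    (hpo : ∀ (c : N → R), (∀ j, good j (c j)) → ∀ {F G : R ⥤ K} {f : F ⟶ G} {a b},
      IsPushout a (cellsMap (c := c) x) f b → Acc F → Acc G)
    (hlift : ∀ F, Acc F → ∀ j (a : S j ⟶ F.obj ⊤), ∃ r, good j r ∧
      ∃ a' : S j ⟶ F.obj r, a' ≫ F.map (homOfLE le_top) = a) :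
    ∃ (Y' : ChainLift (R := R) E) (f : Y ⟶ Y'), Y'.IsGood E Acc (Order.succ n) ∧
      ∃ (c : N → R) (_ : ∀ j, good j (c j)) (a : cells c S ⟶ Y.left) (b : cells c T ⟶ Y'.left),
        IsPushout a (cellsMap x) f.left b := by
  obtain ⟨F, y, φ⟩ := Y
  obtain ⟨h₁, h₂, h₃⟩ := hY
  dsimp only at h₁ h₂ h₃
  obtain rfl := h₁
  let φ' : F.obj ⊤ ≅ E.F.obj n := @asIso _ _ _ _ φ h₂
  choose c hc a' ha' using fun j => hlift F h₃ j (a j ≫ φ'.inv)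
  obtain ⟨G, f, b', ψ, sq', hf⟩ := exists_attach φ' sq a' fun j => by
    rw [reassoc_of% (ha' j)]; simp
  refine ⟨⟨G, (Order.succ n : J₀), ψ.hom⟩,
    { left := f, right := homOfLE (WithTop.coe_le_coe.2 (Order.le_succ n)), w := hf },
    ⟨rfl, ?_, ?_⟩, c, hc, _, _, sq'⟩
  · exact inferInstanceAs (IsIso ψ.hom)
  · exact hpo c hc sq' h₃

end

end CellularAlgebras

namespace CellularAlgebras

open SmallObject

section

variable {K : Type u} [Category.{v} K] [HasColimitsOfSize.{v, v} K]
variable {R : Type v} [Preorder R] [OrderTop R]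
  {J₀ : Type v} [LinearOrder J₀] [OrderBot J₀] [SuccOrder J₀] [NoMaxOrder J₀]
    [WellFoundedLT J₀] {A B : K} {i : A ⟶ B} (E : TransfiniteCompositionOfShape J₀ i)

theorem exists_chainLift (Acc : ObjectProperty (R ⥤ K))
    {N : J₀ → Type v} {S T : ∀ n, N n → K} (x : ∀ n j, S n j ⟶ T n j)
    (good : ∀ n, N n → R → Prop)
    {a : ∀ n j, S n j ⟶ E.F.obj n} {b : ∀ n j, T n j ⟶ E.F.obj (Order.succ n)}
    (sq : ∀ n, IsPushout (Sigma.desc (a n)) (Limits.Sigma.map (x n))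
      (E.F.map (homOfLE (Order.le_succ n))) (Sigma.desc (b n)))
    (hpo : ∀ n (c : N n → R), (∀ j, good n j (c j)) → ∀ {F G : R ⥤ K} {f : F ⟶ G} {a b},
      IsPushout a (cellsMap (c := c) (x n)) f b → Acc F → Acc G)
    (hlift : ∀ F, Acc F → ∀ n j (a : S n j ⟶ F.obj ⊤), ∃ r, good n j r ∧
      ∃ a' : S n j ⟶ F.obj r, a' ≫ F.map (homOfLE le_top) = a)
    (hcolim : ∀ (𝒟 : Type v) [SmallCategory 𝒟], Acc.IsClosedUnderColimitsOfShape 𝒟)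
    (F₀ : R ⥤ K) (hF₀ : Acc F₀) (φ₀ : F₀.obj ⊤ ≅ A) :
    ∃ (c : (Σ n, N n) → R) (_ : ∀ j, good j.1 j.2 (c j)) (F : R ⥤ K) (f : F₀ ⟶ F)
      (_ : (attachCells c fun j => x j.1 j.2).TransfiniteCompositionOfShape J₀ f)
      (ψ : F.obj ⊤ ≅ B), f.app ⊤ ≫ ψ.hom = φ₀.hom ≫ i := by
  have hsucc : ∀ Y : ChainLift (R := R) E, ∃ (Y' : ChainLift (R := R) E) (f : Y ⟶ Y'),
      ∀ n, Y.IsGood E Acc n → (Y'.IsGood E Acc (Order.succ n) ∧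
      ∃ (c : N n → R) (_ : ∀ j, good n j (c j)) (a : cells c (S n) ⟶ Y.left)
        (b : cells c (T n) ⟶ Y'.left), IsPushout a (cellsMap (x n)) f.left b) := by
    intro Y
    by_cases h : ∃ n, Y.IsGood E Acc n
    · obtain ⟨n, hn⟩ := h
      obtain ⟨Y', f, h₁, h₂⟩ := exists_chainLift_succ E Acc n Y hn (x n) (good n) (sq n)
        (hpo n) (fun F hF => hlift F hF n)
      refine ⟨Y', f, fun m hm => ?_⟩
      obtain rfl : m = n := WithTop.coe_injective (hm.right.symm.trans hn.right)
      exact ⟨h₁, h₂⟩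
    · exact ⟨Y, 𝟙 Y, fun n hn => absurd ⟨n, hn⟩ h⟩
  choose succ toSucc hs using hsucc
  let Φ : SuccStruct (ChainLift (R := R) E) :=
    { X₀ := ⟨F₀, ((⊥ : J₀) : WithTop J₀), φ₀.hom ≫ E.isoBot.inv⟩
      succ := succ
      toSucc := toSucc }
  have (𝒟 : Type v) [SmallCategory 𝒟] : HasColimitsOfShape 𝒟 (WithTop J₀) :=
    hasColimitsOfShape_withTop 𝒟
  have : HasIterationOfShape J₀ (ChainLift (R := R) E) := { }
  let Z := Φ.iterationFunctor J₀
  have hZ (n : J₀) : (Z.obj n).IsGood E Acc n := by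
    induction n using SuccOrder.limitRecOn with
    | isMin n hn =>
      obtain rfl := hn.eq_bot
      have : Z.obj ⊥ = Φ.X₀ := (Φ.iter ⊥).obj_bot
      rw [this]
      exact ⟨rfl, inferInstanceAs (IsIso (φ₀.hom ≫ E.isoBot.inv)), hF₀⟩
    | succ n hn h =>
      rw [← (Φ.prop_iterationFunctor_map_succ n hn).succ_eq]
      exact (hs _ n h).1
    | isSuccLimit n hn h =>
      have hc := Z.isColimitOfIsWellOrderContinuous n hn
      have hlt (m : Set.Iio n) : (Z.obj m.1).IsGood E Acc m.1 := h m.1 m.2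
      have h₁ := isColimitOfPreserves (Comma.snd _ _) hc
      have hr : (Z.obj n).right = n := by
        apply le_antisymm
        · refine isLUB_of_isColimit h₁ fun m => ?_
          have := (hlt m).right
          exact this.le.trans (WithTop.coe_le_coe.2 m.2.le)
        · by_contra hlt'
          rw [not_le] at hlt'
          obtain ⟨m, hm⟩ := WithTop.ne_top_iff_exists.1 (ne_top_of_lt hlt')
          rw [← hm, WithTop.coe_lt_coe] at hlt'
          have h₂ := leOfHom (Z.map (homOfLE (hn.succ_lt hlt').le)).right
          rw [(h _ (hn.succ_lt hlt')).right, ← hm, WithTop.coe_le_coe] at h₂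
          exact (Order.lt_succ m).not_ge h₂
      refine ⟨hr, ?_, ?_⟩
      · refine isIso_hom_of_isColimit (isColimitOfPreserves (Comma.fst _ _ ⋙ _) hc)
          (Nonempty.some ?_) fun m => (hlt m).isIso
        refine nonempty_isColimit_extendedChain E ((Comma.snd _ _).mapCocone _) Subtype.val
          (fun _ _ h => h) (fun m => (hlt m).right) _
          (E.F.isColimitOfIsWellOrderContinuous n hn)
          ((extendedChain E).mapIso (eqToIso hr.symm)) fun m => ?_
        change (extendedChain E).map (homOfLE (WithTop.coe_le_coe.2 m.2.le)) ≫
          (extendedChain E).map (eqToHom hr.symm) = _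
        rw [← Functor.map_comp]
        rfl
      · have := hcolim (Set.Iio n)
        exact Acc.prop_of_isColimit (isColimitOfPreserves (Comma.fst _ _) hc)
          (fun m => (hlt m).acc)
  have hstep (n : J₀) : ∃ (c : N n → R) (_ : ∀ j, good n j (c j))
      (a : cells c (S n) ⟶ (Z.obj n).left) (b : cells c (T n) ⟶ (Z.obj (Order.succ n)).left),
      IsPushout a (cellsMap (x n)) (Z.map (homOfLE (Order.le_succ n))).left b := by
    obtain ⟨c, hc, a, b, sq⟩ := (hs _ n (hZ n)).2
    have := (Φ.iterationFunctorObjSuccIso n (not_isMax n))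
    refine ⟨c, hc, a, b ≫ (Φ.iterationFunctorObjSuccIso n (not_isMax n)).inv.left, ?_⟩
    rw [Φ.iterationFunctor_map_succ n (not_isMax n)]
    refine sq.of_iso (Iso.refl _) (Iso.refl _) (Iso.refl _)
      ((Comma.fst _ _).mapIso (Φ.iterationFunctorObjSuccIso n (not_isMax n)).symm) ?_ ?_ ?_ ?_
    all_goals simp [Φ]
    rfl
  choose c hc a' b' sq' using hstep
  have : PreservesWellOrderContinuousOfShape J₀
      (Comma.fst ((evaluation R K).obj ⊤) (extendedChain E)) := { }
  let τ := (Φ.transfiniteCompositionOfShapeιIteration J₀).toTransfiniteCompositionOfShape.map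
    (Comma.fst _ _)
  have htop : (Φ.iteration J₀).right = ⊤ := by
    by_contra hne
    obtain ⟨m, hm⟩ := WithTop.ne_top_iff_exists.1 hne
    have h₂ := leOfHom ((Φ.iterationCocone J₀).ι.app (Order.succ m)).right
    have h₃ : ((Order.succ m : J₀) : WithTop J₀) ≤ (Φ.iteration J₀).right := by
      rw [← (hZ (Order.succ m)).right]
      exact h₂
    rw [← hm, WithTop.coe_le_coe] at h₃
    exact (Order.lt_succ m).not_ge h₃
  have hiso : IsIso (Φ.iteration J₀).hom := by
    refine isIso_hom_of_isColimit (isColimitOfPreserves (Comma.fst _ _ ⋙ _)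
      (Φ.isColimitIterationCocone J₀)) (Nonempty.some ?_) fun m => (hZ m).isIso
    refine nonempty_isColimit_extendedChain E ((Comma.snd _ _).mapCocone _) id
      (fun _ _ h => h) (fun m => (hZ m).right) _ E.isColimit
      ((extendedChain E).mapIso (eqToIso htop.symm)) fun m => ?_
    change (extendedChain E).map (homOfLE le_top : (m : WithTop J₀) ⟶ ⊤) ≫
      (extendedChain E).map (eqToHom htop.symm) = _
    rw [← Functor.map_comp]
    rfl
  refine ⟨fun j => c j.1 j.2, fun j => hc j.1 j.2, (Φ.iteration J₀).left,
    (Φ.ιIteration J₀).left,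
    { toTransfiniteCompositionOfShape := τ, map_mem := ?_ },
    @asIso _ _ _ _ _ hiso ≪≫ (extendedChain E).mapIso (eqToIso htop), ?_⟩
  · intro n hn
    refine ⟨N n, Sigma.mk n, sigma_mk_injective, ?_⟩
    exact ⟨a' n, b' n, sq' n⟩
  · have h₁ := (Φ.ιIteration J₀).w
    change (Φ.ιIteration J₀).left.app ⊤ ≫ (Φ.iteration J₀).hom = (φ₀.hom ≫ E.isoBot.inv) ≫
      (extendedChain E).map (Φ.ιIteration J₀).right at h₁
    have h₂ : (extendedChain E).map (Φ.ιIteration J₀).right ≫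
        (extendedChain E).map (eqToHom htop) = E.incl.app ⊥ := by
      rw [← Functor.map_comp]
      rfl
    change (Φ.ιIteration J₀).left.app ⊤ ≫ (Φ.iteration J₀).hom ≫
      (extendedChain E).map (eqToHom htop) = _
    rw [← assoc, h₁]
    exact (assoc _ _ _).trans ((congr_arg (fun t => (φ₀.hom ≫ E.isoBot.inv) ≫ t) h₂).trans
      ((assoc _ _ _).trans (congr_arg (fun t => φ₀.hom ≫ t) E.fac)))

end

end CellularAlgebras

namespace CellularAlgebras

section

variable {K : Type u} [Category.{v} K] {R : Type v} [Preorder R]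

/-- The functors which send a given cocone to a colimit cocone. -/
def sendsToColimit (K : Type u) [Category.{v} K] {I : Type u'} [Category.{u''} I] {q : I ⥤ R}
    (s : Cocone q) : ObjectProperty (R ⥤ K) :=
  fun F => Nonempty (IsColimit (F.mapCocone s))

instance {I : Type u'} [Category.{u''} I] {q : I ⥤ R} (s : Cocone q) (𝒟 : Type*) [Category 𝒟]
    [HasColimitsOfShape 𝒟 K] : (sendsToColimit K s).IsClosedUnderColimitsOfShape 𝒟 where
  colimitsOfShape_le G hG := by
    obtain ⟨⟨Z, ι, hc⟩, hZ⟩ := hG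
    have h (d : 𝒟) : IsColimit ((Z.obj d).mapCocone s) := (hZ d).some
    let hr (r : R) := isColimitOfPreserves ((evaluation R K).obj r) hc
    let T (t : Cocone (q ⋙ G)) (d : 𝒟) : Cocone (q ⋙ Z.obj d) :=
      { pt := t.pt
        ι :=
          { app := fun i => (ι.app d).app (q.obj i) ≫ t.ι.app i
            naturality := fun i j f => by
              have := t.w f
              dsimp at this ⊢
              rw [← this]
              simp } }
    have hT (t : Cocone (q ⋙ G)) (d : 𝒟) (i : I) : (Z.obj d).map (s.ι.app i) ≫ (h d).desc (T t d) =
        (ι.app d).app (q.obj i) ≫ t.ι.app i := (h d).fac (T t d) i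
    let S (t : Cocone (q ⋙ G)) : Cocone (Z ⋙ (evaluation R K).obj s.pt) :=
      { pt := t.pt
        ι :=
          { app := fun d => (h d).desc (T t d)
            naturality := fun d e f => (h d).hom_ext fun i => by
              dsimp
              rw [NatTrans.naturality_assoc, hT, comp_id, hT]
              have := congr_app (ι.naturality f) (q.obj i)
              dsimp at this
              rw [comp_id] at this
              rw [← this, assoc] } }
    have hS (t : Cocone (q ⋙ G)) (d : 𝒟) : (ι.app d).app s.pt ≫ (hr s.pt).desc (S t) =
        (h d).desc (T t d) := (hr s.pt).fac (S t) d
    exact ⟨{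
      desc := fun t => (hr s.pt).desc (S t)
      fac := fun t i => (hr (q.obj i)).hom_ext fun d => by
        dsimp
        rw [← NatTrans.naturality_assoc, hS, hT]
      uniq := fun t m hm => (hr s.pt).hom_ext fun d => by
        dsimp
        rw [hS]
        refine (h d).hom_ext fun i => ?_
        refine Eq.trans ?_ (hT t d i).symm
        rw [← hm]
        dsimp
        rw [NatTrans.naturality_assoc] }⟩

lemma prop_of_transfiniteComposition {X : MorphismProperty K} (Q : ObjectProperty K)
    [Q.IsClosedUnderIsomorphisms]
    {J₀ : Type v} [LinearOrder J₀] [OrderBot J₀] [SuccOrder J₀] [WellFoundedLT J₀]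
    {A B : K} {f : A ⟶ B} (E : X.TransfiniteCompositionOfShape J₀ f)
    (hX : ∀ {A B : K} (f : A ⟶ B), X f → Q A → Q B)
    (h₁ : Q.IsClosedUnderColimitsOfShape J₀)
    (h₂ : ∀ j : J₀, Q.IsClosedUnderColimitsOfShape (Set.Iio j)) (hA : Q A) : Q B := by
  refine Q.prop_of_isColimit E.isColimit fun j => ?_
  induction j using SuccOrder.limitRecOn with
  | isMin n hn =>
    obtain rfl := hn.eq_bot
    exact Q.prop_of_iso E.isoBot.symm hA
  | succ n hn h => exact hX _ (E.map_mem n hn) h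
  | isSuccLimit n hn h =>
    have := h₂ n
    exact Q.prop_of_isColimit (E.F.isColimitOfIsWellOrderContinuous n hn) fun m => h m.1 m.2

lemma prop_of_isPushout (Q : ObjectProperty K) [Q.IsClosedUnderColimitsOfShape WalkingSpan]
    {A B A' B' : K} {f : A ⟶ B} {g : A ⟶ A'} {g' : B ⟶ B'} {f' : A' ⟶ B'}
    (sq : IsPushout f g g' f') (hA : Q A) (hB : Q B) (hA' : Q A') : Q B' := by
  refine Q.prop_of_isColimit sq.isColimit fun j => ?_
  rcases j with _ | _ | _ <;> assumption

end

end CellularAlgebras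

namespace CellularAlgebras

lemma hasCardinalLT_arrow_of_preorder {J : Type u} [Preorder J] {κ : Cardinal.{w}}
    (hκ : Cardinal.aleph0 ≤ κ) (hJ : HasCardinalLT J κ) : HasCardinalLT (Arrow J) κ := by
  refine (hasCardinalLT_prod hκ hJ hJ).of_injective (fun a : Arrow J => (a.left, a.right)) ?_
  rintro ⟨a, b, f⟩ ⟨a', b', f'⟩ h
  obtain ⟨h₁, h₂⟩ := Prod.mk.inj h
  change a = a' at h₁
  change b = b' at h₂
  subst h₁ h₂
  obtain rfl : f = f' := Subsingleton.elim (α := a ⟶ b) _ _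
  rfl

section

variable {K : Type u} [Category.{v} K] [HasColimitsOfSize.{v, v} K] {R : Type v} [Preorder R]
  {J₀ : Type v} [LinearOrder J₀] [OrderBot J₀] [SuccOrder J₀] [WellFoundedLT J₀]
  {N : Type v} {c : N → R} {D E : N → K} {x : ∀ j, D j ⟶ E j}
  {F G : R ⥤ K} {f : F ⟶ G}

lemma sendsToColimit_of_attachCells
    (τ : (attachCells c x).TransfiniteCompositionOfShape J₀ f)
    {I : Type u'} [Category.{u''} I] {q : I ⥤ R} (s : Cocone q)
    (hs : ∀ {M : Type v} (m : M → N), m.Injective → ∀ D : M → K,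
      sendsToColimit K s (cells (c ∘ m) D))
    (hF : sendsToColimit K s F) : sendsToColimit K s G := by
  have := hasColimitsOfSizeShrink.{0, 0, v, v} K
  refine prop_of_transfiniteComposition (sendsToColimit K s) τ ?_ inferInstance
    (fun _ => inferInstance) hF
  rintro A B f ⟨M, m, hm, a, b, sq⟩ hA
  exact prop_of_isPushout _ sq (hs m hm _) hA (hs m hm _)

lemma isCardinalPresentable_of_attachCells {κ : Cardinal.{v}} [Fact κ.IsRegular]
    (τ : (attachCells c x).TransfiniteCompositionOfShape J₀ f) (hJ₀ : HasCardinalLT J₀ κ) (r : R)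
    (hr : HasCardinalLT {j // c j ≤ r} κ)
    (hD : ∀ j, IsCardinalPresentable (D j) κ) (hE : ∀ j, IsCardinalPresentable (E j) κ)
    (hF : IsCardinalPresentable (F.obj r) κ) : IsCardinalPresentable (G.obj r) κ := by
  let τ' := τ.toTransfiniteCompositionOfShape.map ((evaluation R K).obj r)
  have hκ : Cardinal.aleph0 ≤ κ := (Fact.out : κ.IsRegular).aleph0_le
  have h₁ {J : Type v} [Preorder J] (hJ : HasCardinalLT J κ) :
      (isCardinalPresentable K κ).IsClosedUnderColimitsOfShape J := by
    refine isClosedUnderColimitsOfShape_isCardinalPresentable (κ := κ) K ?_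
    exact hasCardinalLT_arrow_of_preorder hκ hJ
  have h₂ : (isCardinalPresentable K κ).IsClosedUnderColimitsOfShape WalkingSpan := by
    refine isClosedUnderColimitsOfShape_isCardinalPresentable (κ := κ) K ?_
    exact hasCardinalLT_of_finite _ _ hκ
  refine prop_of_transfiniteComposition (isCardinalPresentable K κ) (A := F.obj r)
    (X := fun A B _ => isCardinalPresentable K κ A → isCardinalPresentable K κ B)
    (f := f.app r) { toTransfiniteCompositionOfShape := τ', map_mem := ?_ } (fun f hf => hf)
    (h₁ hJ₀) (fun j => h₁ (hJ₀.of_injective _ Subtype.val_injective)) hF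
  intro j hj hA
  obtain ⟨M, m, hm, a, b, sq⟩ := τ.map_mem j hj
  have hM : HasCardinalLT {j // (c ∘ m) j ≤ r} κ :=
    hr.of_injective (fun j => (⟨m j.1, j.2⟩ : {j // c j ≤ r})) fun j j' h =>
      Subtype.ext (hm (congr_arg Subtype.val h))
  have h₃ (D : N → K) (hD : ∀ j, IsCardinalPresentable (D j) κ) :
      isCardinalPresentable K κ ((cells (c ∘ m) (D ∘ m)).obj r) := by
    have : (isCardinalPresentable K κ).IsClosedUnderColimitsOfShape
        (Discrete {j // (c ∘ m) j ≤ r}) :=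
      isClosedUnderColimitsOfShape_isCardinalPresentable (κ := κ) K
        ((hasCardinalLT_iff_of_equiv (Arrow.discreteEquiv _) κ).2 hM)
    exact ObjectProperty.prop_colimit _ _ fun j => hD _
  exact prop_of_isPushout _ (sq.map ((evaluation R K).obj r)) (h₃ D hD) hA (h₃ E hE)

lemma llp_of_attachCells (τ : (attachCells c x).TransfiniteCompositionOfShape J₀ f)
    {W : MorphismProperty K} (hx : ∀ j, W.llp (x j)) {r₁ r₂ : R} (φ : r₁ ⟶ r₂)
    (hF : IsIso (F.map φ)) : W.llp (G.map φ) := by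
  intro X₀ Y₀ p hp
  have := hasColimitsOfSizeShrink.{0, 0, v, v} K
  let ev := (Functor.whiskeringLeft _ _ K).obj (ComposableArrows.mk₁ φ)
  let q : ComposableArrows.mk₁ (𝟙 X₀) ⟶ ComposableArrows.mk₁ p :=
    ComposableArrows.homMk₁ (𝟙 X₀) p rfl
  let Q : MorphismProperty (ComposableArrows K 1) := .ofHoms fun _ : Unit => q
  have h₁ {A B} (g : A ⟶ B) (hg : attachCells c x g) : Q.llp (ev.map g) := by
    obtain ⟨M, m, hm, a, b, sq⟩ := hg
    refine Q.llp.of_isPushout (sq.map ev) (fun A' B' q' hq' => ?_)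
    obtain ⟨⟩ := hq'
    constructor
    intro u w comm
    have e₀ := NatTrans.congr_app comm.w 0
    have e₁ := NatTrans.congr_app comm.w 1
    have nu := u.naturality (homOfLE (by simp) : (0 : Fin 2) ⟶ 1)
    have nw := w.naturality (homOfLE (by simp) : (0 : Fin 2) ⟶ 1)
    let u₀ : (cells (c ∘ m) (D ∘ m)).obj r₁ ⟶ X₀ := u.app 0
    let u₁ : (cells (c ∘ m) (D ∘ m)).obj r₂ ⟶ X₀ := u.app 1
    let w₀ : (cells (c ∘ m) (E ∘ m)).obj r₁ ⟶ X₀ := w.app 0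
    let w₁ : (cells (c ∘ m) (E ∘ m)).obj r₂ ⟶ Y₀ := w.app 1
    replace e₀ : u₀ ≫ 𝟙 X₀ = (cellsMap fun j => x (m j)).app r₁ ≫ w₀ := e₀
    replace e₁ : u₁ ≫ p = (cellsMap fun j => x (m j)).app r₂ ≫ w₁ := e₁
    replace nu : (cells (c ∘ m) (D ∘ m)).map φ ≫ u₁ = u₀ ≫ 𝟙 X₀ := nu
    replace nw : (cells (c ∘ m) (E ∘ m)).map φ ≫ w₁ = w₀ ≫ p := nw
    have hl (j : M) (hj : c (m j) ≤ r₂) : ∃ l : E (m j) ⟶ X₀,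
        x (m j) ≫ l = cellι (D ∘ m) j hj ≫ u₁ ∧ l ≫ p = cellι (E ∘ m) j hj ≫ w₁ ∧
          ∀ h : c (m j) ≤ r₁, cellι (E ∘ m) j h ≫ w₀ = l := by
      by_cases h : c (m j) ≤ r₁
      · refine ⟨cellι (E ∘ m) j h ≫ w₀, ?_, ?_, fun _ => rfl⟩
        · have := cellι_cellsMap_app_assoc (c := c ∘ m) (fun j => x (m j)) j h w₀
          rw [← e₀, comp_id] at this
          rw [comp_id] at nu
          refine this.symm.trans ?_
          rw [← nu]
          exact cellι_map_assoc _ _ _ _ _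
        · rw [assoc, ← nw]
          exact cellι_map_assoc _ _ _ _ _
      · have := hx (m j) p hp
        have sq : CommSq (cellι (D ∘ m) j hj ≫ u₁) (x (m j)) p (cellι (E ∘ m) j hj ≫ w₁) :=
          ⟨by rw [assoc, e₁]; exact cellι_cellsMap_app_assoc _ _ _ _⟩
        exact ⟨sq.lift, sq.fac_left, sq.fac_right, fun h' => absurd h' h⟩
    choose l hl₁ hl₂ hl₃ using hl
    let l' : (cells (c ∘ m) (E ∘ m)).obj r₂ ⟶ X₀ := cellsObjDesc l
    have l'₀ : (cells (c ∘ m) (E ∘ m)).map φ ≫ l' = w₀ ≫ 𝟙 X₀ :=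
      cells_hom_ext fun j hj => by
        rw [cellι_map_assoc, cellι_objDesc, comp_id, hl₃]
    refine ⟨⟨{ l := ComposableArrows.homMk₁ w₀ l' l'₀, fac_left := ?_, fac_right := ?_ }⟩⟩
    · refine ComposableArrows.hom_ext₁ ?_ ?_
      · exact e₀.symm.trans (comp_id _)
      · change (cellsMap fun j => x (m j)).app r₂ ≫ l' = u₁
        refine cells_hom_ext fun j hj => ?_
        rw [cellι_cellsMap_app_assoc, cellι_objDesc]
        exact hl₁ j hj
    · refine ComposableArrows.hom_ext₁ (comp_id _) ?_
      change l' ≫ p = w₁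
      refine cells_hom_ext fun j hj => ?_
      rw [cellι_objDesc_assoc]
      exact hl₂ j hj
  have : PreservesWellOrderContinuousOfShape J₀ ev := { }
  have h₂ : Q.llp (ev.map f) := by
    refine Q.llp.transfiniteCompositionsOfShape_le J₀ _ ⟨?_⟩
    exact { toTransfiniteCompositionOfShape := τ.toTransfiniteCompositionOfShape.map ev,
            map_mem := fun j hj => h₁ _ (τ.map_mem j hj) }
  constructor
  intro u w comm
  have := h₂ q ⟨()⟩
  have nat : F.map φ ≫ f.app r₂ = f.app r₁ ≫ G.map φ := f.naturality φ
  let i : F.obj r₂ ⟶ F.obj r₁ := inv (F.map φ)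
  let U : ComposableArrows.mk₁ (F.map φ) ⟶ ComposableArrows.mk₁ (𝟙 X₀) :=
    ComposableArrows.homMk₁ (f.app r₁ ≫ u) (i ≫ f.app r₁ ≫ u)
      ((IsIso.hom_inv_id_assoc (F.map φ) _).trans (comp_id _).symm)
  let V : ComposableArrows.mk₁ (G.map φ) ⟶ ComposableArrows.mk₁ p :=
    ComposableArrows.homMk₁ u w comm.w.symm
  let e (F : R ⥤ K) : ev.obj F ≅ ComposableArrows.mk₁ (F.map φ) :=
    ComposableArrows.isoMk₁ (Iso.refl _) (Iso.refl _) ((comp_id _).trans (id_comp _).symm)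
  have sq : CommSq ((e F).hom ≫ U) (ev.map f) q ((e G).hom ≫ V) := ⟨by
    refine ComposableArrows.hom_ext₁ ?_ ?_
    · change (𝟙 _ ≫ f.app r₁ ≫ u) ≫ 𝟙 _ = f.app r₁ ≫ 𝟙 _ ≫ u
      simp
    · change (𝟙 _ ≫ i ≫ f.app r₁ ≫ u) ≫ p = f.app r₂ ≫ 𝟙 _ ≫ w
      rw [← cancel_epi (F.map φ)]
      simp [i, comm.w, reassoc_of% nat]⟩
  refine ⟨⟨{ l := sq.lift.app 1, fac_left := ?_, fac_right := ?_ }⟩⟩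
  · have h₃ := sq.lift.naturality (homOfLE (by simp) : (0 : Fin 2) ⟶ 1)
    have h₄ := NatTrans.congr_app sq.fac_right 0
    replace h₃ : G.map φ ≫ sq.lift.app 1 = sq.lift.app 0 ≫ 𝟙 X₀ := h₃
    replace h₄ : sq.lift.app 0 ≫ 𝟙 X₀ = 𝟙 _ ≫ u := h₄
    exact h₃.trans (h₄.trans (id_comp _))
  · have h₄ := NatTrans.congr_app sq.fac_right 1
    replace h₄ : sq.lift.app 1 ≫ p = 𝟙 _ ≫ w := h₄
    exact h₄.trans (id_comp _)

end

end CellularAlgebras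

namespace CellularAlgebras

section

variable {R : Type v} [Preorder R] {K : Type u} [Category.{v} K]

/-- A commutative square in a preorder, as a cocone. -/
def spanCocone {r s t u : R} (hrs : r ≤ s) (hrt : r ≤ t) (hsu : s ≤ u) (htu : t ≤ u) :
    Cocone (span (homOfLE hrs) (homOfLE hrt)) :=
  PushoutCocone.mk (homOfLE hsu) (homOfLE htu) (Subsingleton.elim _ _)

lemma sendsToColimit_spanCocone_iff {r s t u : R} (hrs : r ≤ s) (hrt : r ≤ t) (hsu : s ≤ u)
    (htu : t ≤ u) (F : R ⥤ K) :
    sendsToColimit K (spanCocone hrs hrt hsu htu) F ↔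
      IsPushout (F.map (homOfLE hrs)) (F.map (homOfLE hrt)) (F.map (homOfLE hsu))
        (F.map (homOfLE htu)) := by
  have w : homOfLE hrs ≫ homOfLE hsu = homOfLE hrt ≫ homOfLE htu := Subsingleton.elim _ _
  constructor
  · rintro ⟨h⟩
    exact ⟨⟨by rw [← F.map_comp, w, F.map_comp]⟩,
      ⟨isColimitMapCoconePushoutCoconeEquiv F w h⟩⟩
  · intro h
    exact ⟨(isColimitMapCoconePushoutCoconeEquiv F w).symm h.isColimit⟩

lemma sendsToColimit_spanCocone_cells [HasColimitsOfSize.{v, v} K] {J : Type v} {c : J → R}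
    (D : J → K) {r s t u : R} (hrs : r ≤ s)
    (hrt : r ≤ t) (hsu : s ≤ u) (htu : t ≤ u) (h₁ : ∀ j, c j ≤ u → c j ≤ s ∨ c j ≤ t)
    (h₂ : ∀ j, c j ≤ s → c j ≤ t → c j ≤ r) :
    sendsToColimit K (spanCocone hrs hrt hsu htu) (cells c D) := by
  classical
  rw [sendsToColimit_spanCocone_iff]
  have w : (cells c D).map (homOfLE hrs) ≫ (cells c D).map (homOfLE hsu) =
      (cells c D).map (homOfLE hrt) ≫ (cells c D).map (homOfLE htu) := by
    rw [← (cells c D).map_comp, ← (cells c D).map_comp]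
    rfl
  refine ⟨⟨w⟩, ⟨PushoutCocone.IsColimit.mk w
    (fun S => cellsObjDesc fun j hj => if h : c j ≤ s then cellι D j h ≫ S.inl else
      cellι D j ((h₁ j hj).resolve_left h) ≫ S.inr) ?_ ?_ ?_⟩⟩
  · intro S
    refine cells_hom_ext fun j hj => ?_
    rw [cellι_map_assoc, cellι_objDesc, dif_pos hj]
  · intro S
    refine cells_hom_ext fun j hj => ?_
    rw [cellι_map_assoc, cellι_objDesc]
    split_ifs with h
    · have := cellι D j (h₂ j h hj) ≫= S.condition
      rwa [cellι_map_assoc, cellι_map_assoc] at this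
    · rfl
  · intro S m hm₁ hm₂
    refine cells_hom_ext fun j hj => ?_
    rw [cellι_objDesc]
    split_ifs with h
    · rw [← hm₁, cellι_map_assoc]
    · rw [← hm₂, cellι_map_assoc]

end

section

variable {N : Type w} (T : N → Set N)

/-- The smallest set containing `S` and closed under `T`. -/
def dependencyClosure (S : Set N) : Set N :=
  {j | ∃ i ∈ S, Relation.ReflTransGen (fun i j => j ∈ T i) i j}

lemma subset_dependencyClosure (S : Set N) : S ⊆ dependencyClosure T S :=
  fun i hi => ⟨i, hi, .refl⟩

lemma dependencyClosure_mono : Monotone (dependencyClosure T) := by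
  rintro S S' h j ⟨i, hi, hij⟩
  exact ⟨i, h hi, hij⟩

lemma dependencyClosure_closed {S : Set N} {j : N} (hj : j ∈ dependencyClosure T S) :
    T j ⊆ dependencyClosure T S := by
  obtain ⟨i, hi, hij⟩ := hj
  exact fun k hk => ⟨i, hi, hij.tail hk⟩

lemma dependencyClosure_union (S S' : Set N) :
    dependencyClosure T (S ∪ S') = dependencyClosure T S ∪ dependencyClosure T S' := by
  ext j
  constructor
  · rintro ⟨i, hi | hi, hij⟩
    · exact Or.inl ⟨i, hi, hij⟩
    · exact Or.inr ⟨i, hi, hij⟩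
  · rintro (⟨i, hi, hij⟩ | ⟨i, hi, hij⟩)
    · exact ⟨i, Or.inl hi, hij⟩
    · exact ⟨i, Or.inr hi, hij⟩

lemma dependencyClosure_empty : dependencyClosure T ∅ = ∅ := by
  ext j
  exact ⟨fun ⟨i, hi, _⟩ => hi, fun h => h.elim⟩

lemma hasCardinalLT_dependencyClosure {κ : Cardinal.{w}} [Fact κ.IsRegular]
    (hκ : Cardinal.aleph0 < κ) (hT : ∀ j, HasCardinalLT (T j) κ) {S : Set N}
    (hS : HasCardinalLT S κ) : HasCardinalLT (dependencyClosure T S) κ := by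
  let cl : ℕ → Set N := fun n => Nat.rec S (fun _ A => ⋃ i : A, T i) n
  have hcl (n : ℕ) : HasCardinalLT (↥(cl n)) κ := by
    induction n with
    | zero => exact hS
    | succ n h => exact hasCardinalLT_iUnion _ h fun i => hT i
  refine (hasCardinalLT_iUnion cl ?_ hcl).of_injective
    (Set.inclusion ?_) (Set.inclusion_injective _)
  · simpa [HasCardinalLT] using hκ
  · rintro j ⟨i, hi, hij⟩
    induction hij with
    | refl => exact Set.mem_iUnion.2 ⟨0, hi⟩
    | tail _ h ih =>
      obtain ⟨n, hn⟩ := Set.mem_iUnion.1 ih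
      exact Set.mem_iUnion.2 ⟨n + 1, Set.mem_iUnion.2 ⟨⟨_, hn⟩, h⟩⟩

end

section

variable {K : Type u} [Category.{v} K]

/-- Morphisms between `κ`-presentable objects. -/
def presMaps (K : Type u) [Category.{v} K] (κ : Cardinal.{v}) [Fact κ.IsRegular] :
    MorphismProperty K :=
  fun A B _ => IsCardinalPresentable A κ ∧ IsCardinalPresentable B κ

/-- Functors on a power set which preserve filtered unions. -/
def PreservesUnions {N : Type v} (Φ : Set N ⥤ K) : Prop :=
  ∀ (D : Type v) [SmallCategory D] [IsFiltered D] (q : D ⥤ Set N) (s : Cocone q),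
    (∀ j ∈ s.pt, ∃ d, j ∈ q.obj d) → Nonempty (IsColimit (Φ.mapCocone s))

/-- Functors on a power set which preserve filtered unions and send the addition of a `κ`-small
set to a pushout of a morphism of `W` between `κ`-presentable objects. -/
structure FatCellFunctor (W : MorphismProperty K) (κ : Cardinal.{v}) [Fact κ.IsRegular]
    {N : Type v} (Φ : Set N ⥤ K) : Prop where
  preservesUnions : PreservesUnions Φ
  pushouts (S T : Set N) (hT : HasCardinalLT T κ) :
    (W ⊓ presMaps K κ).pushouts (Φ.map (homOfLE (Set.subset_union_left : S ⊆ S ∪ T)))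

/-- `i` is the composite of a fat cell complex. -/
def IsFat (W : MorphismProperty K) (κ : Cardinal.{v}) [Fact κ.IsRegular] {A B : K}
    (i : A ⟶ B) : Prop :=
  ∃ (N : Type v) (Φ : Set N ⥤ K) (_ : FatCellFunctor W κ Φ) (α : A ≅ Φ.obj ∅)
    (β : Φ.obj Set.univ ≅ B), α.hom ≫ Φ.map (homOfLE (Set.empty_subset _)) ≫ β.hom = i

end

end CellularAlgebras

namespace CellularAlgebras

open SmallObject

section

variable {K : Type u} [Category.{v} K] [HasColimitsOfSize.{v, v} K] {R : Type v} [Preorder R]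
  {J₀ : Type v} [LinearOrder J₀] [OrderBot J₀] [SuccOrder J₀] [WellFoundedLT J₀]
  {N : Type v} {c : N → R} {D E : N → K} {x : ∀ j, D j ⟶ E j}
  {F G : R ⥤ K} {f : F ⟶ G}

lemma isIso_app_of_attachCells (τ : (attachCells c x).TransfiniteCompositionOfShape J₀ f) (r : R)
    (hr : ∀ j, ¬ c j ≤ r) : IsIso (f.app r) := by
  have : (⊤ : MorphismProperty K).llp (f.app r) := by
    refine (⊤ : MorphismProperty K).llp.transfiniteCompositionsOfShape_le J₀ _
      ⟨{ toTransfiniteCompositionOfShape :=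
          τ.toTransfiniteCompositionOfShape.map ((evaluation R K).obj r)
         map_mem := fun j hj => ?_ }⟩
    obtain ⟨M, m, hm, a, b, sq⟩ := τ.map_mem j hj
    have := hasColimitsOfSizeShrink.{0, 0, v, v} K
    refine (⊤ : MorphismProperty K).llp.of_isPushout (sq.map ((evaluation R K).obj r)) ?_
    intro X Y p _
    constructor
    intro s t _
    exact ⟨⟨{ l := cellsObjDesc (c := c ∘ m) (D := E ∘ m) (r := r) fun j h => (hr _ h).elim
              fac_left := cells_hom_ext fun j h => (hr _ h).elim
              fac_right := cells_hom_ext (c := c ∘ m) (D := E ∘ m) (r := r)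
                fun j h => (hr _ h).elim }⟩⟩
  have := this (f.app r) trivial
  have sq : CommSq (𝟙 _) (f.app r) (f.app r) (𝟙 _) := ⟨by simp⟩
  exact ⟨sq.lift, sq.fac_left, sq.fac_right⟩

end

/-- The poset indexing a fat cell complex: the first coordinate indexes a colimit presentation of
the domain, the second one is a set of cells. -/
def FatIndex (P N : Type v) : Type v := WithTop P × Set N

instance (P N : Type v) [PartialOrder P] : PartialOrder (FatIndex P N) :=
  inferInstanceAs (PartialOrder (WithTop P × Set N))

instance (P N : Type v) [PartialOrder P] : OrderTop (FatIndex P N) :=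
  inferInstanceAs (OrderTop (WithTop P × Set N))

/-- Elements of `FatIndex P N`. -/
def FatIndex.mk {P N : Type v} (p : WithTop P) (S : Set N) : FatIndex P N := (p, S)

/-- The first projection. -/
def FatIndex.fst (P N : Type v) [PartialOrder P] : FatIndex P N ⥤ WithTop P :=
  Monotone.functor (f := Prod.fst) fun _ _ h => h.1

section

variable {K : Type u} [Category.{v} K] [HasColimitsOfSize.{v, v} K] {κ : Cardinal.{v}}
  [Fact κ.IsRegular] {P : Type v} [PartialOrder P] [IsCardinalFiltered P κ] {G : P ⥤ K}
  {cG : Cocone G} (hc : IsColimit cG)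
  {J₀ : Type v} [LinearOrder J₀] [OrderBot J₀] [SuccOrder J₀] [WellFoundedLT J₀]
  {N : Type v} {c : N → FatIndex P N} {D E : N → K} {x : ∀ j, D j ⟶ E j}
  {F : FatIndex P N ⥤ K} {f : FatIndex.fst P N ⋙ withTopFunctor G cG ⟶ F}

/-- The functor sending a subset to the value of `F` at its closure. -/
def closureFunctor (T : N → Set N) (P : Type v) [PartialOrder P] :
    Set N ⥤ FatIndex P N :=
  Monotone.functor (f := fun S => FatIndex.mk (⊤ : WithTop P) (dependencyClosure T S))
    fun _ _ h => ⟨le_rfl, dependencyClosure_mono T h⟩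

lemma preservesUnions_of_attachCells
    (τ : (attachCells c x).TransfiniteCompositionOfShape J₀ f)
    (hmem : ∀ j, j ∈ (c j).2) :
    PreservesUnions (closureFunctor (fun j => (c j).2) P ⋙ F) := by
  intro 𝒟 _ _ q s hs
  refine sendsToColimit_of_attachCells τ ((closureFunctor (fun j => (c j).2) P).mapCocone s) ?_ ?_
  · intro M m _ D
    refine nonempty_isColimit_cells D _ _ fun j hj => ?_
    obtain ⟨i, hi, hij⟩ := hj.2 (hmem (m j))
    obtain ⟨d, hd⟩ := hs i hi
    exact ⟨d, le_top, dependencyClosure_closed _ ⟨i, hd, hij⟩⟩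
  · have := IsFiltered.isConnected 𝒟
    exact ⟨isColimitConstCocone 𝒟 cG.pt⟩

lemma pushouts_of_attachCells (hG : ∀ p, IsCardinalPresentable (G.obj p) κ)
    (hκ : Cardinal.aleph0 < κ) {W : MorphismProperty K}
    (τ : (attachCells c x).TransfiniteCompositionOfShape J₀ f) (hJ₀ : HasCardinalLT J₀ κ)
    (hmem : ∀ j, j ∈ (c j).2) (hc₁ : ∀ j, ∃ p : P, (c j).1 = p)
    (hc₂ : ∀ j, HasCardinalLT (c j).2 κ)
    (hD : ∀ j, IsCardinalPresentable (D j) κ) (hE : ∀ j, IsCardinalPresentable (E j) κ)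
    (hx : ∀ j, W.llp (x j)) (S T : Set N) (hT : HasCardinalLT T κ) :
    (W.llp ⊓ presMaps K κ).pushouts ((closureFunctor (fun j => (c j).2) P ⋙ F).map
      (homOfLE (Set.subset_union_left : S ⊆ S ∪ T))) := by
  let cl := dependencyClosure fun j => (c j).2
  choose p hp using hc₁
  have hT' : HasCardinalLT (cl T) κ := hasCardinalLT_dependencyClosure _ hκ hc₂ hT
  have hST : HasCardinalLT (cl T ∩ cl S : Set N) κ :=
    hT'.of_injective (Set.inclusion Set.inter_subset_left) (Set.inclusion_injective _)
  let p₀ : P := IsCardinalFiltered.max (fun j : cl T => p j) hT'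
  have hp₀ (j) (hj : j ∈ cl T) : (c j).1 ≤ (p₀ : WithTop P) := by
    rw [hp]
    exact WithTop.coe_le_coe.2
      (leOfHom (IsCardinalFiltered.toMax (fun j : cl T => p j) hT' ⟨j, hj⟩))
  have h₁ : (FatIndex.mk (p₀ : WithTop P) (cl T ∩ cl S)) ≤ (FatIndex.mk (⊤ : WithTop P) (cl S)) :=
    ⟨le_top, Set.inter_subset_right⟩
  have h₂ : (FatIndex.mk (p₀ : WithTop P) (cl T ∩ cl S)) ≤ (FatIndex.mk (p₀ : WithTop P) (cl T)) :=
    ⟨le_rfl, Set.inter_subset_left⟩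
  have h₃ : (FatIndex.mk (⊤ : WithTop P) (cl S)) ≤ (FatIndex.mk (⊤ : WithTop P) (cl (S ∪ T))) :=
    ⟨le_rfl, dependencyClosure_mono _ Set.subset_union_left⟩
  have h₄ : (FatIndex.mk (p₀ : WithTop P) (cl T)) ≤
      FatIndex.mk (⊤ : WithTop P) (cl (S ∪ T)) :=
    ⟨le_top, dependencyClosure_mono _ Set.subset_union_right⟩
  have sq : sendsToColimit K (spanCocone h₁ h₂ h₃ h₄) F := by
    refine sendsToColimit_of_attachCells τ _ ?_ ?_
    · intro M m _ D
      refine sendsToColimit_spanCocone_cells D _ _ _ _ ?_ ?_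
      · intro j hj
        have : _ ∈ cl (S ∪ T) := hj.2 (hmem _)
        change _ ∈ dependencyClosure _ _ at this
        rw [dependencyClosure_union] at this
        obtain h | h := this
        · exact Or.inl ⟨le_top, dependencyClosure_closed _ h⟩
        · exact Or.inr ⟨hp₀ _ h, dependencyClosure_closed _ h⟩
      · intro j hj hj'
        exact ⟨hj'.1, Set.subset_inter hj'.2 hj.2⟩
    · rw [sendsToColimit_spanCocone_iff]
      have (A B : FatIndex P N) (φ : A ⟶ B) (h : A.1 = B.1) :
          IsIso ((FatIndex.fst P N ⋙ withTopFunctor G cG).map φ) := by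
        have : IsIso ((FatIndex.fst P N).map φ) := ⟨homOfLE h.ge, rfl, rfl⟩
        exact inferInstanceAs (IsIso ((withTopFunctor G cG).map ((FatIndex.fst P N).map φ)))
      have i₁ := this _ _ (homOfLE h₂) rfl
      have i₂ := this _ _ (homOfLE h₃) rfl
      exact IsPushout.of_vert_isIso ⟨by rw [← Functor.map_comp, ← Functor.map_comp]; rfl⟩
  have hpres {S : Set N} (hS : HasCardinalLT S κ) :
      IsCardinalPresentable (F.obj (FatIndex.mk (p₀ : WithTop P) S)) κ :=
    isCardinalPresentable_of_attachCells τ hJ₀ _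
      (hS.of_injective (fun j => ⟨j.1, j.2.2 (hmem _)⟩) fun i j h =>
        Subtype.ext (Subtype.mk.inj h)) hD hE (hG p₀)
  refine ⟨_, _, F.map (homOfLE h₂), _, _, ⟨?_, hpres hST, hpres hT'⟩,
    (sendsToColimit_spanCocone_iff ..).1 sq⟩
  exact llp_of_attachCells τ hx _
    (inferInstanceAs (IsIso ((withTopFunctor G cG).map (𝟙 (p₀ : WithTop P)))))

end

section

variable {K : Type u} [Category.{v} K] [HasColimitsOfSize.{v, v} K] {κ : Cardinal.{v}}
  [Fact κ.IsRegular] {P : Type v} [PartialOrder P] [IsCardinalFiltered P κ] {G : P ⥤ K}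
  {cG : Cocone G}
  {J₀ : Type v} [LinearOrder J₀] [OrderBot J₀] [SuccOrder J₀] [WellFoundedLT J₀] [NoMaxOrder J₀]

theorem isFat_of_transfiniteComposition (hκ : Cardinal.aleph0 < κ) {X : MorphismProperty K}
    (hX : X ≤ presMaps K κ) (hJ₀ : HasCardinalLT J₀ κ)
    (hc : IsColimit cG) (hG : ∀ p, IsCardinalPresentable (G.obj p) κ) {B : K} {i : cG.pt ⟶ B}
    (E : (MorphismProperty.coproducts.{v} X).pushouts.TransfiniteCompositionOfShape J₀ i) :
    IsFat X.rlp.llp κ i := by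
  have hsq (n : J₀) := exists_of_pushouts_coproducts (E.map_mem n (not_isMax n))
  choose N S T x a b hx sq using hsq
  let P' := Σ n, N n
  let Q : P × HasCardinalLT.Set P' κ ⥤ FatIndex P P' :=
    { obj := fun d => FatIndex.mk d.1 d.2.1
      map := fun φ => homOfLE ⟨WithTop.coe_le_coe.2 (leOfHom φ.1), leOfHom φ.2⟩ }
  let s : Cocone Q := { pt := ⊤, ι := { app := fun d => homOfLE le_top } }
  have : IsFiltered (P × HasCardinalLT.Set P' κ) := isFiltered_of_isCardinalFiltered _ κ
  have hF₀ : sendsToColimit K s (FatIndex.fst P P' ⋙ withTopFunctor G cG) :=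
    ⟨(Functor.Final.isColimitWhiskerEquiv (CategoryTheory.Prod.fst P (HasCardinalLT.Set P' κ))
      cG).symm hc⟩
  let φ₀ : (FatIndex.fst P P' ⋙ withTopFunctor G cG).obj ⊤ ≅ cG.pt := Iso.refl cG.pt
  obtain ⟨c, hgood, F, f, τ, ψ, hψ⟩ := exists_chainLift E.toTransfiniteCompositionOfShape
    (sendsToColimit K s) x
    (fun n j r => (∃ p : P, r.1 = p) ∧ HasCardinalLT r.2 κ ∧ (⟨n, j⟩ : P') ∈ r.2) sq
    (fun n c hc F G f a b sq hF => by
      have := hasColimitsOfSizeShrink.{0, 0, v, v} K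
      have h (D) : sendsToColimit K s (cells c D) := nonempty_isColimit_cells D Q s fun j _ => by
        obtain ⟨⟨p, hp⟩, h, -⟩ := hc j
        exact ⟨(p, ⟨_, h⟩), hp.le, le_rfl⟩
      exact prop_of_isPushout _ sq (h _) hF (h _))
    (fun F hF n j g => by
      have := (hX _ (hx n j)).1
      obtain ⟨⟨p, A⟩, g', hg⟩ := IsCardinalPresentable.exists_hom_of_isColimit κ hF.some g
      have h : Q.obj (p, A) ≤ FatIndex.mk p (A.1 ∪ {⟨n, j⟩}) := ⟨le_rfl, Set.subset_union_left⟩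
      refine ⟨FatIndex.mk p (A.1 ∪ {⟨n, j⟩}), ⟨⟨p, rfl⟩, ?_, Or.inr rfl⟩,
        g' ≫ F.map (homOfLE h), ?_⟩
      · have hκ' := (Fact.out : κ.IsRegular).aleph0_le
        exact hasCardinalLT_union hκ' A.2 (hasCardinalLT_of_finite _ _ hκ')
      · rw [assoc, ← F.map_comp, ← hg]
        rfl)
    (fun 𝒟 _ => inferInstance) _ hF₀ φ₀
  have hfat : FatCellFunctor X.rlp.llp κ (closureFunctor (fun j => (c j).2) P ⋙ F) :=
    ⟨preservesUnions_of_attachCells τ fun j => (hgood j).2.2,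
      pushouts_of_attachCells hG hκ τ hJ₀ (fun j => (hgood j).2.2) (fun j => (hgood j).1)
      (fun j => (hgood j).2.1) (fun j => (hX _ (hx j.1 j.2)).1) (fun j => (hX _ (hx j.1 j.2)).2)
      (fun j => MorphismProperty.le_llp_rlp _ _ (hx j.1 j.2))⟩
  refine ⟨P', closureFunctor (fun j => (c j).2) P ⋙ F, hfat, ?_⟩
  have he : dependencyClosure (fun j => (c j).2) ∅ = ∅ := dependencyClosure_empty _
  have hu : (⊤ : FatIndex P P') ≤ (closureFunctor (fun j => (c j).2) P).obj Set.univ :=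
    ⟨le_rfl, subset_dependencyClosure _ _⟩
  have hiso := isIso_app_of_attachCells τ ((closureFunctor (fun j => (c j).2) P).obj ∅)
      (fun j hj => by
    have : j ∈ dependencyClosure (fun j => (c j).2) ∅ := hj.2 (hgood j).2.2
    rwa [he] at this)
  let e : (closureFunctor (fun j => (c j).2) P).obj Set.univ ≅ ⊤ :=
    ⟨homOfLE le_top, homOfLE hu, rfl, rfl⟩
  let α : cG.pt ≅ F.obj ((closureFunctor (fun j => (c j).2) P).obj ∅) :=
    @asIso _ _ _ _ (f.app ((closureFunctor (fun j => (c j).2) P).obj ∅)) hiso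
  refine ⟨α, F.mapIso e ≪≫ ψ, ?_⟩
  have h₁ : f.app ((closureFunctor (fun j => (c j).2) P).obj ∅) ≫ F.map (homOfLE le_top) =
      f.app ⊤ := (f.naturality _).symm.trans (id_comp _)
  have h₂ : f.app ⊤ ≫ ψ.hom = i := hψ.trans (id_comp _)
  refine Eq.trans ?_ h₂
  rw [← h₁]
  refine Eq.trans ?_ (assoc _ _ _).symm
  change f.app _ ≫ F.map _ ≫ F.map _ ≫ ψ.hom = f.app _ ≫ _
  rw [← F.map_comp_assoc]
  rfl

end

end CellularAlgebras

namespace CellularAlgebras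

section

variable {K : Type u} [Category.{v} K]

lemma exists_presentation (κ : Cardinal.{v}) [Fact κ.IsRegular]
    [IsCardinalLocallyPresentable K κ] (A : K) :
    ∃ (P : Type v) (_ : PartialOrder P) (_ : IsCardinalFiltered P κ) (G : P ⥤ K) (c : Cocone G)
      (_ : IsColimit c) (_ : ∀ p, IsCardinalPresentable (G.obj p) κ), c.pt = A := by
  obtain ⟨J, _, _, ⟨p⟩⟩ :=
    (isCardinalFilteredGenerator_isCardinalPresentable K κ).exists_colimitsOfShape A
  obtain ⟨P, _, _, F, _⟩ := IsCardinalFiltered.exists_cardinal_directed J κ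
  exact ⟨P, _, inferInstance, F ⋙ p.diag, (Cocone.mk A p.ι).whisker F,
    (Functor.Final.isColimitWhiskerEquiv F _).symm p.isColimit,
    fun j => p.prop_diag_obj (F.obj j), rfl⟩

lemma isCardinalForSmallObjectArgument (κ : Cardinal.{v}) [Fact κ.IsRegular]
    [OrderBot κ.ord.ToType] [HasColimitsOfSize.{v, v} K] {X : MorphismProperty K}
    [MorphismProperty.IsSmall.{v} X] (hX : X ≤ presMaps K κ) :
    X.IsCardinalForSmallObjectArgument κ where
  hasPushouts := by
    have := hasColimitsOfSizeShrink.{0, 0, v, v} K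
    infer_instance
  hasIterationOfShape := { }
  preservesColimit {A _ _ _} i hi f hf := by
    have := (hX _ hi).1
    have := (coyoneda.obj (op A)).preservesColimitsOfShape_of_isCardinalAccessible κ κ.ord.ToType
    infer_instance

lemma exists_small_of_le_presMaps (κ : Cardinal.{v}) [Fact κ.IsRegular]
    [IsCardinalLocallyPresentable K κ] {X : MorphismProperty K} [X.RespectsIso]
    (hX : X ≤ presMaps K κ) :
    ∃ Y : MorphismProperty K, MorphismProperty.IsSmall.{v} Y ∧ Y ≤ X ∧ X ≤ Y.isoClosure := by
  obtain ⟨Q, _, hQ, hQ'⟩ := ObjectProperty.EssentiallySmall.exists_small_le.{v}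
    (isCardinalPresentable K κ)
  refine ⟨fun A B f => Q A ∧ Q B ∧ X f, ⟨?_⟩, fun _ _ _ h => h.2.2, fun A B f hf => ?_⟩
  · have : LocallySmall.{v} K := inferInstance
    let φ : (Σ (A : Subtype Q) (B : Subtype Q), Shrink.{v} (A.1 ⟶ B.1)) → Arrow K :=
      fun a => Arrow.mk ((equivShrink _).symm a.2.2)
    refine small_subset.{v} (s := Set.range φ) ?_
    rintro ⟨A, B, f⟩ ⟨hA, hB, -⟩
    exact ⟨⟨⟨A, hA⟩, ⟨B, hB⟩, equivShrink _ f⟩, by simp [φ]; rfl⟩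
  · obtain ⟨A', hA, ⟨eA⟩⟩ := hQ' _ (hX _ hf).1
    obtain ⟨B', hB, ⟨eB⟩⟩ := hQ' _ (hX _ hf).2
    exact ⟨A', B', eA.inv ≫ f ≫ eB.hom, ⟨hA, hB, (X.arrow_mk_iso_iff
      (Arrow.isoMk eA eB : Arrow.mk f ≅ Arrow.mk (eA.inv ≫ f ≫ eB.hom))).1 hf⟩,
      ⟨Arrow.isoMk eA.symm eB.symm⟩⟩

lemma rlp_eq_of_le_isoClosure {X Y : MorphismProperty K} (h : Y ≤ X) (h' : X ≤ Y.isoClosure) :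
    Y.rlp = X.rlp := by
  refine le_antisymm ?_ (MorphismProperty.antitone_rlp h)
  rw [← MorphismProperty.le_llp_iff_le_rlp]
  have : Y.isoClosure ≤ Y.rlp.llp := by
    rw [MorphismProperty.isoClosure_le_iff]
    exact Y.le_llp_rlp
  exact h'.trans this

lemma exists_isFat_rlp_of_isSmall {κ₀ κ : Cardinal.{v}} [Fact κ₀.IsRegular] [Fact κ.IsRegular]
    (hκ : κ₀ < κ) [IsCardinalLocallyPresentable K κ₀] {X : MorphismProperty K}
    [MorphismProperty.IsSmall.{v} X] (hX : X ≤ presMaps K κ₀) {A B : K} (f : A ⟶ B) :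
    ∃ (Z : K) (i : A ⟶ Z) (p : Z ⟶ B), IsFat X.rlp.llp κ i ∧ X.rlp p ∧ i ≫ p = f := by
  have : Nonempty κ₀.ord.ToType :=
    IsFiltered.nonempty (self := isFiltered_of_isCardinalFiltered _ κ₀)
  let := WellFoundedLT.toOrderBot κ₀.ord.ToType
  have := isCardinalForSmallObjectArgument κ₀ hX
  have := IsCardinalLocallyPresentable.of_le K hκ.le
  have : NoMaxOrder κ₀.ord.ToType := Cardinal.noMaxOrder (Cardinal.IsRegular.aleph0_le Fact.out)
  obtain ⟨P, _, _, G, c, hc, hG, rfl⟩ := exists_presentation κ A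
  refine ⟨_, SmallObject.ιObj X κ₀ f, SmallObject.πObj X κ₀ f, ?_, SmallObject.rlp_πObj X κ₀ f,
    SmallObject.ιObj_πObj X κ₀ f⟩
  obtain ⟨E⟩ := SmallObject.transfiniteCompositionsOfShape_ιObj X κ₀ f
  refine isFat_of_transfiniteComposition (J₀ := κ₀.ord.ToType)
    (lt_of_le_of_lt (Cardinal.IsRegular.aleph0_le Fact.out) hκ) ?_ ?_ hc hG E
  · exact fun _ _ f hf => ⟨isCardinalPresentable_monotone K hκ.le _ (hX f hf).1,
      isCardinalPresentable_monotone K hκ.le _ (hX f hf).2⟩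
  · rw [hasCardinalLT_iff_cardinal_mk_lt]
    simpa using hκ

/-- The small object argument with fat cell complexes. -/
theorem exists_isFat_rlp {κ₀ κ : Cardinal.{v}} [Fact κ₀.IsRegular] [Fact κ.IsRegular]
    (hκ : κ₀ < κ) [IsCardinalLocallyPresentable K κ₀] {X : MorphismProperty K}
    [X.RespectsIso] (hX : X ≤ presMaps K κ₀) {A B : K} (f : A ⟶ B) :
    ∃ (Z : K) (i : A ⟶ Z) (p : Z ⟶ B), IsFat X.rlp.llp κ i ∧ X.rlp p ∧ i ≫ p = f := by
  obtain ⟨Y, _, h, h'⟩ := exists_small_of_le_presMaps κ₀ hX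
  rw [← rlp_eq_of_le_isoClosure h h']
  exact exists_isFat_rlp_of_isSmall hκ (h.trans hX) f

end

end CellularAlgebras

namespace CellularAlgebras

open CellularPaper (IsTransfiniteCompositionOf IsCellular coconeLT restrictionLT)

section

variable {K : Type u} [Category.{v} K]

lemma isTransfiniteCompositionOf_of_preservesUnions {Z : MorphismProperty K} {N : Type v}
    {Φ : Set N ⥤ K} (hΦ : PreservesUnions Φ)
    (hZ : ∀ (S : Set N) (j : N), j ∉ S →
      Z (Φ.map (homOfLE (Set.subset_union_left : S ⊆ S ∪ {j})))) :
    IsTransfiniteCompositionOf.{v} Z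
      (Φ.map (homOfLE (Set.empty_subset _ : (∅ : Set N) ⊆ Set.univ))) := by
  obtain ⟨_, _⟩ := exists_wellFoundedLT N
  let _ : OrderBot (WithTop N) := WellFoundedLT.toOrderBot _
  let _ : SuccOrder (WithTop N) := .ofLinearWellFoundedLT _
  let I : WithTop N ⥤ Set N := Monotone.functor (f := fun j => {n : N | (n : WithTop N) < j})
    fun a b h n hn => lt_of_lt_of_le hn h
  have h₀ : I.obj ⊥ = ∅ := by
    ext n
    simp [I, Monotone.functor]
  have h₁ : I.obj ⊤ = Set.univ := by
    ext n
    simp [I, Monotone.functor, WithTop.coe_lt_top]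
  refine ⟨WithTop N, inferInstance, inferInstance, inferInstance, inferInstance, I ⋙ Φ, _,
    colimitOfDiagramTerminal isTerminalTop (I ⋙ Φ), Φ.mapIso (eqToIso h₀.symm),
    Φ.mapIso (eqToIso h₁), fun j hj => ?_, fun j hj => ?_, ?_⟩
  · obtain ⟨n, rfl⟩ : ∃ n : N, (n : WithTop N) = j := by
      rw [← WithTop.ne_top_iff_exists]
      rintro rfl
      exact hj isMax_top
    have h₂ : I.obj (Order.succ (n : WithTop N)) = I.obj n ∪ {n} := by
      ext m
      change (m : WithTop N) < Order.succ _ ↔ (m : WithTop N) < n ∨ m = n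
      rw [Order.lt_succ_iff_of_not_isMax hj, WithTop.coe_le_coe, WithTop.coe_lt_coe,
        le_iff_lt_or_eq]
    have := hZ (I.obj n) n (lt_irrefl (n : WithTop N))
    revert this
    generalize_proofs p₁ p₂
    change _ → Z (Φ.map (I.map (homOfLE p₂)))
    generalize I.map (homOfLE p₂) = φ
    revert φ
    rw [h₂]
    intro φ h
    exact h
  · have hne : Nonempty {i : WithTop N // i < j} := by
      obtain ⟨i, hi⟩ := not_isMin_iff.1 hj.1
      exact ⟨⟨i, hi⟩⟩
    have : IsDirectedOrder {i : WithTop N // i < j} := ⟨fun a b => by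
      rcases le_total a b with h | h
      · exact ⟨b, h, le_rfl⟩
      · exact ⟨a, le_rfl, h⟩⟩
    obtain ⟨h⟩ := hΦ {i : WithTop N // i < j} _ (coconeLT I j) fun n hn => by
      have hn : (n : WithTop N) < j := hn
      refine ⟨⟨Order.succ n, hj.succ_lt hn⟩, ?_⟩
      exact Order.lt_succ_of_not_isMax hn.not_isMax
    exact ⟨h⟩
  · dsimp [colimitOfDiagramTerminal]
    rw [← Φ.map_comp, ← Φ.map_comp]
    rfl

end

end CellularAlgebras

namespace CellularAlgebras

open CellularPaper (IsTransfiniteCompositionOf IsCellular coconeLT restrictionLT)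

section

variable {K : Type u} [Category.{v} K]

lemma _root_.CellularPaper.IsCellular.respectsIso {C : MorphismProperty K} (hC : IsCellular C) :
    C.RespectsIso :=
  MorphismProperty.RespectsIso.of_respects_arrow_iso C fun _ _ e hf =>
    hC.pushout (IsPushout.of_vert_isIso (inl := e.hom.right) (g := e.hom.left) ⟨e.hom.w.symm⟩) hf

lemma isTransfiniteCompositionOf_of_transfiniteCompositionOfShape {W : MorphismProperty K}
    {J : Type v} [LinearOrder J] [SuccOrder J] [OrderBot J] [WellFoundedLT J] {A B : K} {f : A ⟶ B}
    (E : W.TransfiniteCompositionOfShape J f) : IsTransfiniteCompositionOf.{v} W f := by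
  refine ⟨J, inferInstance, inferInstance, inferInstance, inferInstance, E.F,
    _, E.isColimit, E.isoBot.symm, Iso.refl _, E.map_mem, fun j hj => ?_, by simp⟩
  have := E.F.isColimitOfIsWellOrderContinuous j hj
  exact ⟨this⟩

lemma transfiniteCompositionsOfShape_le_of_isCellular {C : MorphismProperty K}
    (hC : IsCellular C) {J : Type v} [LinearOrder J] [SuccOrder J] [OrderBot J] [WellFoundedLT J] :
    C.transfiniteCompositionsOfShape J ≤ C := by
  rintro A B f ⟨E⟩
  exact hC.transfinite f (isTransfiniteCompositionOf_of_transfiniteCompositionOfShape E)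

lemma isTransfiniteCompositionOf_le {W : MorphismProperty K} [W.RespectsIso]
    [MorphismProperty.IsStableUnderTransfiniteComposition.{v} W] :
    IsTransfiniteCompositionOf.{v} W ≤ W := by
  rintro A B f ⟨J, _, _, _, _, F, c, hc, eA, eB, h₁, h₂, h₃⟩
  have : F.IsWellOrderContinuous := ⟨h₂⟩
  let E : W.TransfiniteCompositionOfShape J f :=
    { F := F
      isoBot := eA.symm
      isWellOrderContinuous := this
      incl := c.ι ≫ (Functor.const J).map eB.hom
      isColimit := hc.ofIsoColimit (Cocone.ext eB (fun j => rfl))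
      fac := by simpa using h₃
      map_mem := h₁ }
  exact W.transfiniteCompositionsOfShape_le J _ ⟨E⟩

lemma coproducts_le_of_isCellular [HasColimitsOfSize.{v, v} K] {C : MorphismProperty K}
    (hC : IsCellular C) :
    (MorphismProperty.coproducts.{v} C).pushouts ≤ C := by
  intro A B g hg
  have := hasColimitsOfSizeShrink.{0, 0, v, v} K
  have := hC.respectsIso
  obtain ⟨N, D, E, x, a, b, hx, sq⟩ := exists_of_pushouts_coproducts hg
  let F : Set N ⥤ K := (Functor.const _).obj A
  obtain ⟨G, f, b', ψ, sq', hψ⟩ := exists_attach (c := fun j => ({j} : Set N)) (F := F)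
    (Iso.refl A) sq a (fun j => by simp [F])
  let S (s : Set N) := sq'.map ((evaluation (Set N) K).obj s)
  have hF {s t : Set N} (φ : s ⟶ t) : F.map φ = 𝟙 _ := rfl
  have h₀ : IsIso (f.app ∅) := by
    have : IsIso ((cellsMap (c := fun j => ({j} : Set N)) x).app ∅) :=
      ⟨cellsObjDesc fun j hj => (Set.singleton_subset_iff.1 hj).elim,
        cells_hom_ext fun j hj => (Set.singleton_subset_iff.1 hj).elim,
        cells_hom_ext fun j hj => (Set.singleton_subset_iff.1 hj).elim⟩
    exact (MorphismProperty.isomorphisms K).of_isPushout (S ∅) this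
  have h₁ (j : N) : C (f.app {j}) := by
    let e (D : N → K) : (cells (fun j => ({j} : Set N)) D).obj {j} ≅ D j :=
      { hom := cellsObjDesc fun i hi => eqToHom (by rw [Set.singleton_subset_singleton.1 hi])
        inv := cellι D j le_rfl
        hom_inv_id := cells_hom_ext fun i hi => by
          obtain rfl := Set.singleton_subset_singleton.1 hi
          simp
        inv_hom_id := by simp }
    refine hC.pushout (S {j}).flip ((C.arrow_mk_iso_iff (Arrow.isoMk (e D) (e E) ?_)).2 (hx j))
    refine cells_hom_ext fun i hi => ?_
    obtain rfl := Set.singleton_subset_singleton.1 hi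
    have := cellι_cellsMap_app_assoc (c := fun j => ({j} : Set N)) x i hi (cellsObjDesc fun k hk =>
      eqToHom (by rw [Set.singleton_subset_singleton.1 hk]) : _ ⟶ E i)
    refine Eq.trans ?_ this.symm
    have h₂ : cellι D i hi ≫ (e D).hom = 𝟙 _ := (e D).inv_hom_id
    rw [cellι_objDesc]
    exact (assoc _ _ _).symm.trans ((h₂ =≫ x i).trans (by simp))
  have hG (s : Set N) (j : N) (hj : j ∉ s) :
      C (G.map (homOfLE (Set.subset_union_left : s ⊆ s ∪ {j}))) := by
    have sqG : sendsToColimit K (spanCocone (Set.empty_subset s) (Set.empty_subset {j})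
        Set.subset_union_left Set.subset_union_right) G := by
      have hc (D : N → K) := sendsToColimit_spanCocone_cells (c := fun j => ({j} : Set N)) D
        (Set.empty_subset s) (Set.empty_subset {j}) Set.subset_union_left Set.subset_union_right
        (fun i hi => by simpa [or_comm] using hi)
        (fun i hi hi' => by
          obtain rfl := Set.singleton_subset_singleton.1 hi'
          exact (hj (Set.singleton_subset_iff.1 hi)).elim)
      refine prop_of_isPushout _ sq' (hc D) ?_ (hc E)
      rw [sendsToColimit_spanCocone_iff]
      have (A B : Set N) (φ : A ⟶ B) : IsIso (F.map φ) := inferInstanceAs (IsIso (𝟙 _))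
      exact IsPushout.of_vert_isIso ⟨rfl⟩
    rw [sendsToColimit_spanCocone_iff] at sqG
    refine hC.pushout sqG.flip ?_
    have := f.naturality (homOfLE (Set.empty_subset {j}))
    rw [hF, id_comp] at this
    exact (C.arrow_mk_iso_iff (Arrow.isoMk (asIso (f.app ∅)) (Iso.refl _)
      (by simp [this]))).1 (h₁ j)
  have hG' : PreservesUnions G := fun I _ _ q s hs => by
    have hc (D : N → K) := nonempty_isColimit_cells (c := fun j => ({j} : Set N)) D q s
      (fun j hj => by simpa using hs j (by simpa using hj))
    refine prop_of_isPushout (sendsToColimit K s) sq' (hc D) ?_ (hc E)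
    have := IsFiltered.isConnected I
    exact ⟨isColimitConstCocone I A⟩
  have h := hC.transfinite _ (isTransfiniteCompositionOf_of_preservesUnions hG' hG)
  have := f.naturality (homOfLE (Set.empty_subset Set.univ))
  rw [hF, id_comp] at this
  refine (C.arrow_mk_iso_iff (Arrow.isoMk (asIso (f.app ∅)).symm ψ ?_)).1 h
  have hψ' : f.app Set.univ ≫ ψ.hom = g := by rw [← id_comp g]; exact hψ
  simp [← hψ', this]

lemma isTransfiniteCompositionOf_mono {W W' : MorphismProperty K} (h : W ≤ W') :
    IsTransfiniteCompositionOf.{v} W ≤ IsTransfiniteCompositionOf.{v} W' := by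
  rintro A B f ⟨J, _, _, _, _, F, c, hc, eA, eB, h₁, h₂⟩
  exact ⟨J, _, _, _, inferInstance, F, c, hc, eA, eB, fun j hj => h _ (h₁ j hj), h₂⟩

lemma cofClosure_le_of_isCellular {C X : MorphismProperty K} (hC : IsCellular C)
    (hC' : CellularPaper.retracts C ≤ C) (hX : X ≤ C) : CellularPaper.cofClosure X ≤ C := by
  rintro A B f ⟨A', B', g, hg, h⟩
  refine hC' f ⟨A', B', g, hC.transfinite g (isTransfiniteCompositionOf_mono ?_ g hg), h⟩
  rintro A B f ⟨A', B', g, u, w, hg, sq⟩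
  exact hC.pushout sq (hX _ hg)

lemma cofClosure_le_rlp_llp (X : MorphismProperty K) :
    CellularPaper.cofClosure X ≤ X.rlp.llp := by
  refine cofClosure_le_of_isCellular ⟨fun f _ => ?_, fun sq hf => ?_, fun f hf => ?_⟩ ?_
    X.le_llp_rlp
  · exact MorphismProperty.of_isIso _ f
  · exact X.rlp.llp.of_isPushout sq.flip hf
  · exact isTransfiniteCompositionOf_le _ hf
  · rintro A B f ⟨A', B', g, hg, u, w, r, s, h₁, h₂, h₃, h₄⟩
    exact X.rlp.llp.of_retract
      { i := Arrow.homMk u w h₁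
        r := Arrow.homMk r s h₂ } hg

lemma rlp_llp_le_of_isCellular (κ : Cardinal.{v}) [Fact κ.IsRegular]
    [IsCardinalLocallyPresentable K κ] {C X : MorphismProperty K} (hC : IsCellular C)
    (hC' : CellularPaper.retracts C ≤ C) [X.RespectsIso] (hX : X ≤ presMaps K κ)
    (hCX : X ≤ C) : X.rlp.llp ≤ C := by
  have : Nonempty κ.ord.ToType := IsFiltered.nonempty (self := isFiltered_of_isCardinalFiltered _ κ)
  let := WellFoundedLT.toOrderBot κ.ord.ToType
  have : NoMaxOrder κ.ord.ToType := Cardinal.noMaxOrder (Cardinal.IsRegular.aleph0_le Fact.out)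
  obtain ⟨Y, _, h, h'⟩ := exists_small_of_le_presMaps κ hX
  have := isCardinalForSmallObjectArgument κ (h.trans hX)
  rw [← rlp_eq_of_le_isoClosure h h',
    SmallObject.llp_rlp_of_isCardinalForSmallObjectArgument' Y κ]
  rintro A B f ⟨A', B', g, ρ, hg⟩
  refine hC' f ⟨_, _, g,
    transfiniteCompositionsOfShape_le_of_isCellular (J := κ.ord.ToType) hC g ?_, ρ.i.left,
    ρ.i.right, ρ.r.left, ρ.r.right, ρ.i.w, ρ.r.w, by simp [← Arrow.comp_left],
    by simp [← Arrow.comp_right]⟩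
  refine MorphismProperty.transfiniteCompositionsOfShape_monotone _ ?_ g hg
  refine le_trans ?_ (coproducts_le_of_isCellular hC)
  exact MorphismProperty.pushouts_monotone
    (MorphismProperty.coproducts_monotone (h.trans hCX))

end

end CellularAlgebras

namespace CellularAlgebras

section

variable {K : Type u} [Category.{v} K] {κ : Cardinal.{v}} [Fact κ.IsRegular]
  {𝒟 : Type v} [SmallCategory 𝒟] [IsCardinalFiltered 𝒟 κ] {W : 𝒟 ⥤ K} {c : Cocone W}
  {A B : K} {h : A ⟶ B}

/-- Extending a morphism to a stage of a filtered colimit, along a pushout of a morphism between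
presentable objects. -/
lemma exists_lift_of_pushouts_presMaps (hc : IsColimit c) (hh : (presMaps K κ).pushouts h)
    {k₀ : 𝒟} (a : A ⟶ W.obj k₀) (b : B ⟶ c.pt) (w : a ≫ c.ι.app k₀ = h ≫ b) :
    ∃ (k : 𝒟) (φ : k₀ ⟶ k) (b' : B ⟶ W.obj k), h ≫ b' = a ≫ W.map φ ∧ b' ≫ c.ι.app k = b := by
  obtain ⟨A₀, B₀, h₀, a₀, b₀, ⟨hA₀, hB₀⟩, sq⟩ := hh
  have := isFiltered_of_isCardinalFiltered 𝒟 κ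
  obtain ⟨k₁, β, hβ⟩ := IsCardinalPresentable.exists_hom_of_isColimit κ hc (b₀ ≫ b)
  obtain ⟨k, φ, hφ⟩ := IsCardinalPresentable.exists_eq_of_isColimit' κ hc
    (h₀ ≫ β ≫ W.map (IsFiltered.rightToMax k₀ k₁))
    (a₀ ≫ a ≫ W.map (IsFiltered.leftToMax k₀ k₁)) (by simp [hβ, w, sq.w_assoc])
  refine ⟨k, IsFiltered.leftToMax k₀ k₁ ≫ φ,
    sq.desc (a ≫ W.map (IsFiltered.leftToMax k₀ k₁) ≫ W.map φ)
      (β ≫ W.map (IsFiltered.rightToMax k₀ k₁) ≫ W.map φ) (by simpa using hφ.symm), by simp, ?_⟩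
  apply sq.hom_ext <;> simp [w, hβ]

lemma exists_eq_of_pushouts_presMaps (hc : IsColimit c) (hh : (presMaps K κ).pushouts h)
    {k₀ : 𝒟} (b b' : B ⟶ W.obj k₀) (w : h ≫ b = h ≫ b')
    (w' : b ≫ c.ι.app k₀ = b' ≫ c.ι.app k₀) :
    ∃ (k : 𝒟) (φ : k₀ ⟶ k), b ≫ W.map φ = b' ≫ W.map φ := by
  obtain ⟨A₀, B₀, h₀, a₀, b₀, ⟨hA₀, hB₀⟩, sq⟩ := hh
  obtain ⟨k, φ, hφ⟩ := IsCardinalPresentable.exists_eq_of_isColimit' κ hc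
    (b₀ ≫ b) (b₀ ≫ b') (by simp [w'])
  refine ⟨k, φ, sq.hom_ext ?_ (by simpa using hφ)⟩
  rw [reassoc_of% w]

end

end CellularAlgebras

namespace CellularAlgebras

section

variable {R : Type v} [Preorder R] {K : Type u} [Category.{v} K] [HasColimitsOfSize.{v, v} K]

/-- Attaching a cell at the bottom of a functor on a preorder. -/
lemma exists_attach_bot [OrderBot R] [OrderTop R] (F : R ⥤ K) {D E B : K} (x : D ⟶ E)
    (a : D ⟶ F.obj ⊥) {h : F.obj ⊤ ⟶ B} {b : E ⟶ B}
    (sq : IsPushout (a ≫ F.map (homOfLE bot_le)) x h b) :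
    ∃ (G : R ⥤ K) (f : F ⟶ G) (ψ : G.obj ⊤ ≅ B), f.app ⊤ ≫ ψ.hom = h ∧
      (∀ {I : Type v} [SmallCategory I] [IsFiltered I] {q : I ⥤ R} (s : Cocone q),
        sendsToColimit K s F → sendsToColimit K s G) ∧
      (∀ r, ∃ b' : E ⟶ G.obj r, IsPushout (a ≫ F.map (homOfLE bot_le)) x (f.app r) b') ∧
      ∀ {r r' : R} (φ : r ⟶ r'), IsPushout (F.map φ) (f.app r) (f.app r') (G.map φ) := by
  have := hasColimitsOfSizeShrink.{0, 0, v, v} K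
  let a' : (Functor.const R).obj D ⟶ F :=
    { app := fun r => a ≫ F.map (homOfLE bot_le)
      naturality := fun r r' φ => by
        dsimp
        rw [id_comp, assoc, ← F.map_comp]
        rfl }
  have hsq := IsPushout.of_hasPushout a' ((Functor.const R).map x)
  have hr (r : R) := hsq.map ((evaluation R K).obj r)
  refine ⟨_, _, (hr ⊤).isoIsPushout _ _ sq, (hr ⊤).inl_isoIsPushout_hom _ _ sq, ?_,
    fun r => ⟨_, hr r⟩, ?_⟩
  · intro I _ _ q s hs
    have := IsFiltered.isConnected I
    exact prop_of_isPushout _ hsq ⟨isColimitConstCocone I D⟩ hs ⟨isColimitConstCocone I E⟩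
  · intro r r' φ
    refine IsPushout.of_left ?_ (NatTrans.naturality _ _) (hr r)
    have h₁ : ((evaluation R K).obj r).map a' ≫ F.map φ = ((evaluation R K).obj r').map a' := by
      simpa using (a'.naturality φ).symm
    have h₂ := (pushout.inr a' ((Functor.const R).map x)).naturality φ
    dsimp at h₂
    rw [id_comp] at h₂
    rw [h₁]
    erw [← h₂]
    exact hr r'

end

section

variable {R : Type u'} [Preorder R] {K : Type u} [Category.{v} K]

lemma map_homOfLE_comp (F : R ⥤ K) {a b c : R} (h : a ≤ b) (h' : b ≤ c) :
    F.map (homOfLE h) ≫ F.map (homOfLE h') = F.map (homOfLE (h.trans h')) :=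
  (F.map_comp _ _).symm

lemma map_homOfLE_comp_assoc (F : R ⥤ K) {a b c : R} (h : a ≤ b) (h' : b ≤ c) {Z : K}
    (f : F.obj c ⟶ Z) :
    F.map (homOfLE h) ≫ F.map (homOfLE h') ≫ f = F.map (homOfLE (h.trans h')) ≫ f := by
  rw [← assoc, map_homOfLE_comp]

end

section

variable {P : Type v} [PartialOrder P]

/-- The cocone over the inclusion of `P` in `WithTop P` with point `⊤`. -/
def withTopCocone (P : Type v) [PartialOrder P] : Cocone (withTopIncl P) where
  pt := ⊤
  ι := { app := fun _ => homOfLE le_top }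

lemma sendsToColimit_withTopFunctor {K : Type u} [Category.{v} K] {F : P ⥤ K} {c : Cocone F}
    (hc : IsColimit c) : sendsToColimit K (withTopCocone P) (withTopFunctor F c) :=
  ⟨hc⟩

lemma isColimit_ici {κ : Cardinal.{v}} [Fact κ.IsRegular] [IsCardinalFiltered P κ] (k₀ : P) :
    IsCardinalFiltered (Set.Ici k₀) κ ∧
      (Monotone.functor (f := (Subtype.val : Set.Ici k₀ → P)) fun _ _ h => h).Final := by
  have h : IsCardinalFiltered (Set.Ici k₀) κ := isCardinalFiltered_preorder _ _ (fun ι f hι => by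
    have hι : HasCardinalLT ι κ := by rwa [hasCardinalLT_iff_cardinal_mk_lt]
    have := isFiltered_of_isCardinalFiltered P κ
    let m := IsCardinalFiltered.max (fun i => (f i).1) hι
    exact ⟨⟨IsFiltered.max k₀ m, leOfHom (IsFiltered.leftToMax _ _)⟩, fun i =>
      (leOfHom (IsCardinalFiltered.toMax (fun i => (f i).1) hι i)).trans
        (leOfHom (IsFiltered.rightToMax k₀ m))⟩)
  refine ⟨h, ?_⟩
  have := isFiltered_of_isCardinalFiltered P κ
  have := isFiltered_of_isCardinalFiltered (Set.Ici k₀) κ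
  refine Functor.final_of_exists_of_isFiltered _ (fun d => ?_) fun {d c} s s' => ⟨c, 𝟙 _, rfl⟩
  exact ⟨⟨IsFiltered.max k₀ d, leOfHom (IsFiltered.leftToMax _ _)⟩, ⟨IsFiltered.rightToMax _ _⟩⟩

end

section

variable {P : Type v} [PartialOrder P] {κ : Cardinal.{v}} [Fact κ.IsRegular]
  [IsCardinalFiltered P κ] {K : Type u} [Category.{v} K]

lemma exists_lift_withTop {Γ : WithTop P ⥤ K} (hΓ : sendsToColimit K (withTopCocone P) Γ) {A B : K}
    {h : A ⟶ B} (hh : (presMaps K κ).pushouts h) {k₀ : P} (a : A ⟶ Γ.obj k₀) (b : B ⟶ Γ.obj ⊤)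
    (w : a ≫ Γ.map (homOfLE le_top) = h ≫ b) :
    ∃ (k : P) (hk : (k₀ : WithTop P) ≤ k) (b' : B ⟶ Γ.obj k),
      h ≫ b' = a ≫ Γ.map (homOfLE hk) ∧ b' ≫ Γ.map (homOfLE le_top) = b := by
  obtain ⟨hΓ⟩ := hΓ
  obtain ⟨k, φ, b', h₁, h₂⟩ := exists_lift_of_pushouts_presMaps hΓ hh a b w
  exact ⟨k, WithTop.coe_le_coe.2 (leOfHom φ), b', h₁, h₂⟩

lemma exists_eq_withTop {Γ : WithTop P ⥤ K} (hΓ : sendsToColimit K (withTopCocone P) Γ) {A B : K}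
    {h : A ⟶ B} (hh : (presMaps K κ).pushouts h) {k₀ : P} (b b' : B ⟶ Γ.obj k₀)
    (w : h ≫ b = h ≫ b')
    (w' : b ≫ Γ.map (homOfLE le_top) = b' ≫ Γ.map (homOfLE le_top)) :
    ∃ (k : P) (hk : (k₀ : WithTop P) ≤ k), b ≫ Γ.map (homOfLE hk) = b' ≫ Γ.map (homOfLE hk) := by
  obtain ⟨hΓ⟩ := hΓ
  obtain ⟨k, φ, h₁⟩ := exists_eq_of_pushouts_presMaps hΓ hh b b' w w'
  exact ⟨k, WithTop.coe_le_coe.2 (leOfHom φ), h₁⟩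

variable [OrderBot P]

/-- A retraction between the values at `⊤` of two attachments at `⊥` exists at an earlier stage. -/
lemma exists_retractArrow {Γ₀ Γ Q : WithTop P ⥤ K} (f : Γ₀ ⟶ Γ) (g : Γ₀ ⟶ Q)
    (hf : ∀ {r r'} (φ : r ⟶ r'), IsPushout (Γ₀.map φ) (f.app r) (f.app r') (Γ.map φ))
    (hg : ∀ {r r'} (φ : r ⟶ r'), IsPushout (Γ₀.map φ) (g.app r) (g.app r') (Q.map φ))
    (hf' : (presMaps K κ).pushouts (f.app ⊥)) (hg' : (presMaps K κ).pushouts (g.app ⊥))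
    (hΓ : sendsToColimit K (withTopCocone P) Γ) (hQ : sendsToColimit K (withTopCocone P) Q)
    (w : Γ.obj ⊤ ⟶ Q.obj ⊤) (s : Q.obj ⊤ ⟶ Γ.obj ⊤) (hw : f.app ⊤ ≫ w = g.app ⊤)
    (hs : g.app ⊤ ≫ s = f.app ⊤) (hws : w ≫ s = 𝟙 _) :
    ∃ k : P, Nonempty (RetractArrow (f.app (k : WithTop P)) (g.app (k : WithTop P))) := by
  obtain ⟨k₁, l₁, w₁, h₁, h₁'⟩ := exists_lift_withTop (k₀ := (⊥ : P)) hQ hf'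
    (g.app ⊥) (Γ.map (homOfLE bot_le) ≫ w) (by
      rw [← f.naturality_assoc, hw, g.naturality])
  obtain ⟨k₂, l₂, s₁, h₂, h₂'⟩ := exists_lift_withTop (k₀ := k₁) hΓ hg'
    (f.app ⊥ ≫ Γ.map (homOfLE bot_le)) (Q.map (homOfLE bot_le) ≫ s) (by
      rw [assoc, map_homOfLE_comp, ← f.naturality, ← g.naturality_assoc, hs])
  rw [assoc, map_homOfLE_comp] at h₂
  have ex (k : WithTop P) (hk : (k₂ : WithTop P) ≤ k) : ∃ t : Q.obj k ⟶ Γ.obj k,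
      g.app k ≫ t = f.app k ∧ Q.map (homOfLE bot_le) ≫ t = s₁ ≫ Γ.map (homOfLE hk) :=
    ⟨(hg (homOfLE bot_le)).desc (f.app k) (s₁ ≫ Γ.map (homOfLE hk)) (by
      rw [reassoc_of% h₂, map_homOfLE_comp, f.naturality]), by simp, by simp⟩
  have nat {k k' : WithTop P} (hk : (k₂ : WithTop P) ≤ k) (hkk' : k ≤ k') (t : Q.obj k ⟶ Γ.obj k)
      (t' : Q.obj k' ⟶ Γ.obj k') (e : g.app k ≫ t = f.app k)
      (e₁ : Q.map (homOfLE bot_le) ≫ t = s₁ ≫ Γ.map (homOfLE hk))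
      (e' : g.app k' ≫ t' = f.app k')
      (e₁' : Q.map (homOfLE bot_le) ≫ t' = s₁ ≫ Γ.map (homOfLE (hk.trans hkk'))) :
      t ≫ Γ.map (homOfLE hkk') = Q.map (homOfLE hkk') ≫ t' := by
    apply (hg (homOfLE (bot_le : ⊥ ≤ k))).hom_ext
    · rw [reassoc_of% e, ← g.naturality_assoc, e', f.naturality]
    · rw [reassoc_of% e₁, map_homOfLE_comp, map_homOfLE_comp_assoc, e₁']
  obtain ⟨s₂, e₂, e₂'⟩ := ex k₂ le_rfl
  have e₃ := nat le_rfl le_top s₂ s e₂ e₂' hs h₂'.symm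
  obtain ⟨k₃, l₃, h₃⟩ := exists_eq_withTop hΓ hf' (w₁ ≫ Q.map (homOfLE l₂) ≫ s₂)
    (Γ.map (homOfLE bot_le)) (by
      rw [reassoc_of% h₁, map_homOfLE_comp_assoc, ← g.naturality_assoc, e₂, f.naturality]) (by
      rw [assoc, assoc, e₃, map_homOfLE_comp_assoc, reassoc_of% h₁', hws, comp_id,
        map_homOfLE_comp])
  obtain ⟨s₃, e₄, e₄'⟩ := ex k₃ l₃
  have e₅ := nat le_rfl l₃ s₂ s₃ e₂ e₂' e₄ e₄'
  rw [map_homOfLE_comp, assoc, assoc, e₅, map_homOfLE_comp_assoc] at h₃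
  have e₆ : f.app ⊥ ≫ w₁ ≫ Q.map (homOfLE (l₂.trans l₃)) =
      Γ₀.map (homOfLE bot_le) ≫ g.app (k₃ : WithTop P) := by
    rw [reassoc_of% h₁, map_homOfLE_comp, g.naturality]
  let w₃ := (hf (homOfLE (bot_le : ⊥ ≤ (k₃ : WithTop P)))).desc _ _ e₆.symm
  have i₁ : f.app _ ≫ w₃ = g.app _ := IsPushout.inl_desc _ _ _ _
  have i₂ : Γ.map _ ≫ w₃ = w₁ ≫ _ := IsPushout.inr_desc _ _ _ _
  have i₃ : w₃ ≫ s₃ = 𝟙 _ := by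
    apply (hf (homOfLE (bot_le : ⊥ ≤ (k₃ : WithTop P)))).hom_ext
    · rw [reassoc_of% i₁, e₄, comp_id]
    · rw [reassoc_of% i₂, h₃, comp_id]
  exact ⟨k₃, ⟨{
    i := Arrow.homMk (𝟙 _) w₃ (by simp [i₁])
    r := Arrow.homMk (𝟙 _) s₃ (by simp [e₄])
    retract := by
      ext
      · simp
      · simpa using i₃ }⟩⟩

end

end CellularAlgebras

namespace CellularAlgebras

section

lemma comp_comp_comp_inv_eq {K : Type u} [Category.{v} K] {X Y Z W V : K} {a : X ⟶ Y} {b : Y ⟶ Z}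
    {k : X ⟶ Z} {c : Z ⟶ W} (i : V ≅ W) {d : X ⟶ V} (h : a ≫ b = k) (h' : k ≫ c = d ≫ i.hom) :
    a ≫ b ≫ c ≫ i.inv = d := by
  rw [reassoc_of% h, reassoc_of% h', Iso.hom_inv_id, comp_id]

lemma isCardinalPresentable_of_isPushout {K : Type u} [Category.{v} K]
    [HasColimitsOfSize.{v, v} K] {κ : Cardinal.{v}} [Fact κ.IsRegular] {A B A' B' : K} {f : A ⟶ B}
    {g : A ⟶ A'} {f' : A' ⟶ B'} {g' : B ⟶ B'} (sq : IsPushout f g g' f')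
    (hA : IsCardinalPresentable A κ) (hB : IsCardinalPresentable B κ)
    (hA' : IsCardinalPresentable A' κ) : IsCardinalPresentable B' κ := by
  have : (isCardinalPresentable K κ).IsClosedUnderColimitsOfShape WalkingSpan :=
    isClosedUnderColimitsOfShape_isCardinalPresentable (κ := κ) K
      (hasCardinalLT_of_finite _ _ (Fact.out : κ.IsRegular).aleph0_le)
  exact prop_of_isPushout (isCardinalPresentable K κ) sq hA hB hA'

variable {K : Type u} [Category.{v} K] {L : Type u'} [Category.{v} L]
  (U : L ⥤ K) [PreservesColimitsOfSize.{v, v} U] {κ : Cardinal.{v}} [Fact κ.IsRegular]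

lemma map_presMaps_pushouts (hU : ∀ A : L, IsCardinalPresentable A κ →
      IsCardinalPresentable (U.obj A) κ) {A B : L} {h : A ⟶ B}
    (hh : (presMaps L κ).pushouts h) : (presMaps K κ).pushouts (U.map h) := by
  have := preservesColimitsOfSize_shrink.{0, v, 0, v} U
  obtain ⟨A₀, B₀, h₀, a₀, b₀, ⟨hA₀, hB₀⟩, sq⟩ := hh
  exact ⟨_, _, _, _, _, ⟨hU _ hA₀, hU _ hB₀⟩, sq.map U⟩

variable [HasColimitsOfSize.{v, v} K]

lemma pushouts_inverseImage_of_retract_id [IsCardinalLocallyPresentable L κ]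
    (hU : ∀ A : L, IsCardinalPresentable A κ → IsCardinalPresentable (U.obj A) κ)
    {C : MorphismProperty K} [C.IsStableUnderRetracts] [C.IsStableUnderCobaseChange]
    {A B : L} {h : A ⟶ B} (hh : (presMaps L κ).pushouts h) {Q : K} {g : U.obj A ⟶ Q}
    (hg : (C ⊓ presMaps K κ).pushouts g) (w : U.obj B ⟶ Q) (s : Q ⟶ U.obj B)
    (hw : U.map h ≫ w = g) (hs : g ≫ s = U.map h) (hws : w ≫ s = 𝟙 _) :
    (presMaps L κ ⊓ C.inverseImage U).pushouts h := by
  have := preservesColimitsOfSize_shrink.{0, v, 0, v} U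
  obtain ⟨A₀, B₀, h₀, a₀, b₀, ⟨hA₀, hB₀⟩, sq⟩ := hh
  obtain ⟨P₀, Q₀, g₀, p₀, q₀, ⟨hg₀, hP₀, hQ₀⟩, sq'⟩ := hg
  obtain ⟨P, _, _, F, c, hc, hF, rfl⟩ := exists_presentation κ A
  have := isFiltered_of_isCardinalFiltered P κ
  have hUc := isColimitOfPreserves U hc
  obtain ⟨k₁, a₁, ha₁⟩ := IsCardinalPresentable.exists_hom_of_isColimit κ hc a₀
  obtain ⟨k₂, p₁, hp₁⟩ := IsCardinalPresentable.exists_hom_of_isColimit κ hUc p₀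
  obtain ⟨_, _⟩ := isColimit_ici (κ := κ) (IsFiltered.max k₁ k₂)
  have := isFiltered_of_isCardinalFiltered (Set.Ici (IsFiltered.max k₁ k₂)) κ
  let ι : Set.Ici (IsFiltered.max k₁ k₂) ⥤ P :=
    Monotone.functor (f := (Subtype.val : Set.Ici (IsFiltered.max k₁ k₂) → P)) fun _ _ h => h
  have hc' : IsColimit (c.whisker ι) := (Functor.Final.isColimitWhiskerEquiv ι c).symm hc
  let F' : WithTop (Set.Ici (IsFiltered.max k₁ k₂)) ⥤ L := withTopFunctor _ (c.whisker ι)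
  have hF' : sendsToColimit L (withTopCocone _) F' := sendsToColimit_withTopFunctor hc'
  have hUF' : sendsToColimit K (withTopCocone _) (F' ⋙ U) := by
    obtain ⟨h⟩ := hF'
    exact ⟨isColimitOfPreserves U h⟩
  let a : A₀ ⟶ F'.obj ⊥ := a₁ ≫ F.map (IsFiltered.leftToMax k₁ k₂)
  let p : P₀ ⟶ (F' ⋙ U).obj ⊥ := p₁ ≫ U.map (F.map (IsFiltered.rightToMax k₁ k₂))
  have ha : a ≫ F'.map (homOfLE bot_le : ⊥ ⟶ ⊤) = a₀ := by
    refine (assoc _ _ _).trans (Eq.trans ?_ ha₁)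
    congr 1
    exact c.w (IsFiltered.leftToMax k₁ k₂)
  have hp : p ≫ (F' ⋙ U).map (homOfLE bot_le : ⊥ ⟶ ⊤) = p₀ := by
    refine (assoc _ _ _).trans (Eq.trans ?_ hp₁)
    congr 1
    refine (U.map_comp _ _).symm.trans ?_
    exact congrArg U.map (c.w (IsFiltered.rightToMax k₁ k₂))
  obtain ⟨Γ, f, ψ, hψ, hΓ, hf₀, hf⟩ := exists_attach_bot F' h₀ a (h := h) (b := b₀) (by rwa [ha])
  obtain ⟨Φ, g', ψ', hψ', hΦ, hg'₀, hg'⟩ := exists_attach_bot (F' ⋙ U) g₀ p (h := g) (b := q₀)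
    (by rwa [hp])
  have hf₁ (r) : (presMaps L κ).pushouts (f.app r) := by
    obtain ⟨b', hb'⟩ := hf₀ r
    exact ⟨_, _, _, _, _, ⟨hA₀, hB₀⟩, hb'⟩
  have hg'₁ (r) : (C ⊓ presMaps K κ).pushouts (g'.app r) := by
    obtain ⟨b', hb'⟩ := hg'₀ r
    exact ⟨_, _, _, _, _, ⟨hg₀, hP₀, hQ₀⟩, hb'⟩
  have hUΓ : sendsToColimit K (withTopCocone _) (Γ ⋙ U) := by
    obtain ⟨h⟩ := hΓ _ hF'
    exact ⟨isColimitOfPreserves U h⟩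
  obtain ⟨k, ⟨e⟩⟩ := exists_retractArrow (κ := κ) (Functor.whiskerRight f U) g'
    (fun φ => (hf φ).map U) hg' (map_presMaps_pushouts U hU (hf₁ _))
    (MorphismProperty.pushouts_monotone inf_le_right _ (hg'₁ _)) hUΓ (hΦ _ hUF')
    (U.map ψ.hom ≫ w ≫ ψ'.inv) (ψ'.hom ≫ s ≫ U.map ψ.inv) (by
      exact comp_comp_comp_inv_eq ψ' ((U.map_comp _ _).symm.trans (congrArg U.map hψ))
        (hw.trans hψ'.symm)) (by
      exact comp_comp_comp_inv_eq (U.mapIso ψ) hψ'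
        (hs.trans ((congrArg U.map hψ).symm.trans (U.map_comp _ _)))) (by
      simp [reassoc_of% hws, ← U.map_comp])
  have hk : C (U.map (f.app k)) := by
    refine C.of_retract e ?_
    obtain ⟨_, _, _, _, _, hx, hsq⟩ := hg'₁ k
    exact C.of_isPushout hsq hx.1
  have hFk : IsCardinalPresentable (F'.obj k) κ := hF _
  have hΓk : IsCardinalPresentable (Γ.obj k) κ := by
    obtain ⟨b', hb'⟩ := hf₀ k
    exact isCardinalPresentable_of_isPushout hb'.flip hA₀ hB₀ hFk
  refine ⟨_, _, f.app k, c.ι.app k.1, Γ.map (homOfLE le_top) ≫ ψ.hom, ⟨⟨hFk, hΓk⟩, hk⟩, ?_⟩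
  refine (hf (homOfLE le_top : (k : WithTop _) ⟶ ⊤)).of_iso (Iso.refl _) (Iso.refl _) (Iso.refl _) ψ
    ?_ ?_ ?_ ?_
  · exact (comp_id _).trans (id_comp _).symm
  · simp
  · exact hψ.trans (id_comp h).symm
  · simp

/-- A pushout of a morphism between presentable objects whose image is a retract of a pushout of
a morphism of `C` between presentable objects is a pushout of a morphism between presentable
objects whose image is in `C`. -/
theorem pushouts_inverseImage_of_retract [IsCardinalLocallyPresentable L κ]
    (hU : ∀ A : L, IsCardinalPresentable A κ → IsCardinalPresentable (U.obj A) κ)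
    {C : MorphismProperty K} [C.IsStableUnderRetracts] [C.IsStableUnderCobaseChange]
    {A B : L} {h : A ⟶ B} (hh : (presMaps L κ).pushouts h) {P Q : K} {g : P ⟶ Q}
    (hg : (C ⊓ presMaps K κ).pushouts g) (e : RetractArrow (U.map h) g) :
    (presMaps L κ ⊓ C.inverseImage U).pushouts h := by
  have := hasColimitsOfSizeShrink.{0, 0, v, v} K
  have sq := IsPushout.of_hasPushout g e.r.left
  have h₁ : g ≫ e.r.right = e.r.left ≫ U.map h := e.r.w.symm
  have h₂ : e.i.left ≫ g = U.map h ≫ e.i.right := e.i.w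
  have h₃ : e.i.left ≫ e.r.left = 𝟙 _ := by simp
  have h₄ : e.i.right ≫ e.r.right = 𝟙 _ := by simp
  refine pushouts_inverseImage_of_retract_id U hU hh (g := pushout.inr g e.r.left) ?_
    (e.i.right ≫ pushout.inl _ _) (sq.desc e.r.right (U.map h) h₁) ?_ (by simp) (by simp [h₄])
  · obtain ⟨_, _, _, _, _, hx, hsq⟩ := hg
    exact ⟨_, _, _, _, _, hx, hsq.paste_horiz sq.flip⟩
  · rw [← reassoc_of% h₂, sq.w, reassoc_of% h₃]

end

end CellularAlgebras

namespace CellularAlgebras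

section

variable {K : Type u} [Category.{v} K] {N : Type v} {Φ : Set N ⥤ K}

lemma PreservesUnions.exists_desc (hΦ : PreservesUnions Φ) {D : Type v} [Preorder D]
    [IsDirectedOrder D] [Nonempty D] {q : D → Set N} (hq : Monotone q) {S : Set N}
    (hqS : ∀ d, q d ⊆ S) (hS : ∀ j ∈ S, ∃ d, j ∈ q d) {X : K} (t : ∀ d, Φ.obj (q d) ⟶ X)
    (ht : ∀ d d' (h : d ≤ d'), Φ.map (homOfLE (hq h)) ≫ t d' = t d) :
    ∃ t' : Φ.obj S ⟶ X, ∀ d, Φ.map (homOfLE (hqS d)) ≫ t' = t d := by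
  let s : Cocone hq.functor := { pt := S, ι := { app := fun d => homOfLE (hqS d) } }
  obtain ⟨h⟩ := hΦ D hq.functor s hS
  let c : Cocone (hq.functor ⋙ Φ) :=
    { pt := X
      ι :=
        { app := t
          naturality := fun d d' φ => (ht d d' (leOfHom φ)).trans (comp_id _).symm } }
  exact ⟨h.desc c, h.fac c⟩

lemma PreservesUnions.hom_ext (hΦ : PreservesUnions Φ) {D : Type v} [Preorder D]
    [IsDirectedOrder D] [Nonempty D] {q : D → Set N} (hq : Monotone q) {S : Set N}
    (hqS : ∀ d, q d ⊆ S) (hS : ∀ j ∈ S, ∃ d, j ∈ q d) {X : K} {f g : Φ.obj S ⟶ X}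
    (h : ∀ d, Φ.map (homOfLE (hqS d)) ≫ f = Φ.map (homOfLE (hqS d)) ≫ g) : f = g := by
  let s : Cocone hq.functor := { pt := S, ι := { app := fun d => homOfLE (hqS d) } }
  obtain ⟨hc⟩ := hΦ D hq.functor s hS
  exact hc.hom_ext h

/-- `S'` is obtained from `S` by adding less than `κ` elements. -/
def SmallExt (κ : Cardinal.{v}) (S S' : Set N) : Prop :=
  ∃ T : Set N, HasCardinalLT T κ ∧ S' = S ∪ T

variable {κ : Cardinal.{v}}

lemma SmallExt.subset {S S' : Set N} (h : SmallExt κ S S') : S ⊆ S' := by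
  obtain ⟨T, -, rfl⟩ := h
  exact Set.subset_union_left

variable [Fact κ.IsRegular]

lemma SmallExt.refl (S : Set N) : SmallExt κ S S :=
  ⟨∅, hasCardinalLT_of_finite _ _ (Fact.out : κ.IsRegular).aleph0_le, by simp⟩

lemma SmallExt.trans {S S' S'' : Set N} (h : SmallExt κ S S') (h' : SmallExt κ S' S'') :
    SmallExt κ S S'' := by
  obtain ⟨T, hT, rfl⟩ := h
  obtain ⟨T', hT', rfl⟩ := h'
  exact ⟨T ∪ T', hasCardinalLT_union (Fact.out : κ.IsRegular).aleph0_le hT hT',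
    Set.union_assoc _ _ _⟩

lemma SmallExt.pushouts {W : MorphismProperty K} (hΦ : FatCellFunctor W κ Φ) {S S' : Set N}
    (h : SmallExt κ S S') : (W ⊓ presMaps K κ).pushouts (Φ.map (homOfLE h.subset)) := by
  obtain ⟨T, hT, rfl⟩ := h
  exact hΦ.pushouts S T hT

/-- The functor sending a small set `T` to `S ∪ T`. -/
def smallExtFunctor (κ : Cardinal.{v}) (S : Set N) : HasCardinalLT.Set N κ ⥤ Set N :=
  Monotone.functor (f := fun T => S ∪ T.1) fun _ _ h => Set.union_subset_union_right S h

/-- The cocone over `smallExtFunctor κ S` with point the whole set. -/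
def smallExtCocone (κ : Cardinal.{v}) (S : Set N) : Cocone (smallExtFunctor κ S) where
  pt := Set.univ
  ι := { app := fun _ => homOfLE (Set.subset_univ _) }

lemma nonempty_isColimit_smallExtCocone (hΦ : PreservesUnions Φ) (S : Set N) :
    Nonempty (IsColimit (Φ.mapCocone (smallExtCocone κ S))) :=
  hΦ _ _ _ fun j _ => ⟨⟨{j}, hasCardinalLT_of_finite _ _ (Fact.out : κ.IsRegular).aleph0_le⟩,
    Or.inr rfl⟩

lemma exists_lift_union (hΦ : PreservesUnions Φ) {A B : K} {h : A ⟶ B}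
    (hh : (presMaps K κ).pushouts h) {S : Set N} (a : A ⟶ Φ.obj S) (b : B ⟶ Φ.obj Set.univ)
    (w : a ≫ Φ.map (homOfLE (Set.subset_univ _)) = h ≫ b) :
    ∃ (S' : Set N) (hS' : SmallExt κ S S') (b' : B ⟶ Φ.obj S'),
      h ≫ b' = a ≫ Φ.map (homOfLE hS'.subset) ∧
      b' ≫ Φ.map (homOfLE (Set.subset_univ _)) = b := by
  obtain ⟨hc⟩ := nonempty_isColimit_smallExtCocone (κ := κ) hΦ S
  obtain ⟨T, φ, b', h₁, h₂⟩ := exists_lift_of_pushouts_presMaps hc hh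
    (k₀ := ⟨∅, hasCardinalLT_of_finite _ _ (Fact.out : κ.IsRegular).aleph0_le⟩)
    (a ≫ Φ.map (homOfLE Set.subset_union_left)) b (by
      refine Eq.trans (assoc _ _ _) (Eq.trans ?_ w)
      congr 1
      exact map_homOfLE_comp _ _ _)
  refine ⟨S ∪ T.1, ⟨T.1, T.2, rfl⟩, b', h₁.trans ?_, h₂⟩
  rw [assoc]
  congr 1
  exact map_homOfLE_comp _ _ _

lemma exists_eq_union (hΦ : PreservesUnions Φ) {A B : K} {h : A ⟶ B}
    (hh : (presMaps K κ).pushouts h) {S : Set N} (b b' : B ⟶ Φ.obj S) (w : h ≫ b = h ≫ b')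
    (w' : b ≫ Φ.map (homOfLE (Set.subset_univ _)) = b' ≫ Φ.map (homOfLE (Set.subset_univ _))) :
    ∃ (S' : Set N) (hS' : SmallExt κ S S'),
      b ≫ Φ.map (homOfLE hS'.subset) = b' ≫ Φ.map (homOfLE hS'.subset) := by
  obtain ⟨hc⟩ := nonempty_isColimit_smallExtCocone (κ := κ) hΦ S
  have e {T : Set N} (b : B ⟶ Φ.obj S) (h : S ∪ ∅ ⊆ T) :
      (b ≫ Φ.map (homOfLE Set.subset_union_left)) ≫ Φ.map (homOfLE h) =
        b ≫ Φ.map (homOfLE (Set.subset_union_left.trans h)) := by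
    rw [assoc, map_homOfLE_comp]
  obtain ⟨T, φ, h₁⟩ := exists_eq_of_pushouts_presMaps hc hh
    (k₀ := ⟨∅, hasCardinalLT_of_finite _ _ (Fact.out : κ.IsRegular).aleph0_le⟩)
    (b ≫ Φ.map (homOfLE Set.subset_union_left)) (b' ≫ Φ.map (homOfLE Set.subset_union_left))
    (by rw [reassoc_of% w]) ((e b _).trans (w'.trans (e b' _).symm))
  exact ⟨S ∪ T.1, ⟨T.1, T.2, rfl⟩, (e b _).symm.trans (h₁.trans (e b' _))⟩

variable {Γ : Set N ⥤ K}

/-- A compatible retraction of `Φ` onto `Γ` at a set `S`. -/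
structure PartialRetract (v : Γ.obj Set.univ ⟶ Φ.obj Set.univ)
    (r : Φ.obj Set.univ ⟶ Γ.obj Set.univ) (S : Set N) where
  /-- the section -/
  i : Γ.obj S ⟶ Φ.obj S
  /-- the retraction -/
  p : Φ.obj S ⟶ Γ.obj S
  i_p : i ≫ p = 𝟙 _
  i_map : i ≫ Φ.map (homOfLE (Set.subset_univ _)) = Γ.map (homOfLE (Set.subset_univ _)) ≫ v
  p_map : p ≫ Γ.map (homOfLE (Set.subset_univ _)) = Φ.map (homOfLE (Set.subset_univ _)) ≫ r

/-- A stage in the extension of a partial retraction: a section `i` and a retraction `p` which are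
defined on the set `S` and take values on the set `S'`, up to `κ`-small extensions. -/
structure HalfRetract (κ : Cardinal.{v}) {v : Γ.obj Set.univ ⟶ Φ.obj Set.univ}
    {r : Φ.obj Set.univ ⟶ Γ.obj Set.univ} {Q : Set N} (σ : PartialRetract v r Q) where
  S : Set N
  S' : Set N
  ext : SmallExt κ Q S
  ext' : SmallExt κ S S'
  i : Γ.obj S ⟶ Φ.obj S'
  p : Φ.obj S ⟶ Γ.obj S'
  i_map : i ≫ Φ.map (homOfLE (Set.subset_univ _)) = Γ.map (homOfLE (Set.subset_univ _)) ≫ v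
  p_map : p ≫ Γ.map (homOfLE (Set.subset_univ _)) = Φ.map (homOfLE (Set.subset_univ _)) ≫ r
  map_i : Γ.map (homOfLE ext.subset) ≫ i = σ.i ≫ Φ.map (homOfLE (ext.subset.trans ext'.subset))
  map_p : Φ.map (homOfLE ext.subset) ≫ p = σ.p ≫ Γ.map (homOfLE (ext.subset.trans ext'.subset))

variable {v : Γ.obj Set.univ ⟶ Φ.obj Set.univ} {r : Φ.obj Set.univ ⟶ Γ.obj Set.univ}

/-- The compatibility between two successive stages. -/
structure HalfRetract.Rel {Q : Set N} {σ : PartialRetract v r Q} (h h' : HalfRetract κ σ) :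
    Prop where
  le : h.S' ⊆ h'.S
  i_map : h.i ≫ Φ.map (homOfLE (le.trans h'.ext'.subset)) =
    Γ.map (homOfLE (h.ext'.subset.trans le)) ≫ h'.i
  p_map : h.p ≫ Γ.map (homOfLE (le.trans h'.ext'.subset)) =
    Φ.map (homOfLE (h.ext'.subset.trans le)) ≫ h'.p
  i_p : h.i ≫ Φ.map (homOfLE le) ≫ h'.p =
    Γ.map (homOfLE (h.ext'.subset.trans (le.trans h'.ext'.subset)))

lemma HalfRetract.exists_rel {W W' : MorphismProperty K} (hΓ : FatCellFunctor W κ Γ)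
    (hΦ : FatCellFunctor W' κ Φ) (hvr : v ≫ r = 𝟙 _) {Q : Set N} {σ : PartialRetract v r Q}
    (h : HalfRetract κ σ) {S : Set N} (hS : SmallExt κ h.S' S) :
    ∃ h' : HalfRetract κ σ, h'.S = S ∧ h.Rel h' := by
  have hQS := (h.ext.trans h.ext').trans hS
  have pΓ {S : Set N} (hS : SmallExt κ Q S) :=
    MorphismProperty.pushouts_monotone inf_le_right _ (hS.pushouts hΓ)
  have pΦ {S : Set N} (hS : SmallExt κ Q S) :=
    MorphismProperty.pushouts_monotone inf_le_right _ (hS.pushouts hΦ)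
  obtain ⟨S₁, h₁, i₁, hi₁, hi₁'⟩ := exists_lift_union hΦ.preservesUnions (pΓ hQS)
    (σ.i ≫ Φ.map (homOfLE hQS.subset)) (Γ.map (homOfLE (Set.subset_univ _)) ≫ v) (by
      rw [assoc, map_homOfLE_comp, σ.i_map, map_homOfLE_comp_assoc])
  obtain ⟨S₂, h₂, p₂, hp₂, hp₂'⟩ := exists_lift_union hΓ.preservesUnions (pΦ hQS)
    (σ.p ≫ Γ.map (homOfLE (hQS.trans h₁).subset)) (Φ.map (homOfLE (Set.subset_univ _)) ≫ r) (by
      rw [assoc, map_homOfLE_comp, σ.p_map, map_homOfLE_comp_assoc])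
  rw [assoc, map_homOfLE_comp] at hi₁ hp₂
  obtain ⟨S₃, h₃, e₃⟩ := exists_eq_union hΦ.preservesUnions (pΓ h.ext)
    (h.i ≫ Φ.map (homOfLE (((hS.trans h₁).trans h₂).subset)))
    (Γ.map (homOfLE (h.ext'.trans hS).subset) ≫ i₁ ≫ Φ.map (homOfLE h₂.subset)) (by
      rw [reassoc_of% h.map_i, map_homOfLE_comp, map_homOfLE_comp_assoc, reassoc_of% hi₁,
        map_homOfLE_comp]) (by
      rw [assoc, map_homOfLE_comp, h.i_map, assoc, assoc, map_homOfLE_comp, hi₁',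
        map_homOfLE_comp_assoc])
  obtain ⟨S₄, h₄, e₄⟩ := exists_eq_union hΓ.preservesUnions (pΦ h.ext)
    (h.p ≫ Γ.map (homOfLE ((((hS.trans h₁).trans h₂).trans h₃).subset)))
    (Φ.map (homOfLE (h.ext'.trans hS).subset) ≫ p₂ ≫ Γ.map (homOfLE h₃.subset)) (by
      rw [reassoc_of% h.map_p, map_homOfLE_comp, map_homOfLE_comp_assoc, reassoc_of% hp₂,
        map_homOfLE_comp]) (by
      rw [assoc, map_homOfLE_comp, h.p_map, assoc, assoc, map_homOfLE_comp, hp₂',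
        map_homOfLE_comp_assoc])
  obtain ⟨S₅, h₅, e₅⟩ := exists_eq_union hΓ.preservesUnions (pΓ h.ext)
    (h.i ≫ Φ.map (homOfLE hS.subset) ≫ p₂ ≫ Γ.map (homOfLE (h₃.trans h₄).subset))
    (Γ.map (homOfLE (((((h.ext'.trans hS).trans h₁).trans h₂).trans h₃).trans h₄).subset)) (by
      rw [reassoc_of% h.map_i, map_homOfLE_comp_assoc, reassoc_of% hp₂,
        map_homOfLE_comp, map_homOfLE_comp, reassoc_of% σ.i_p]) (by
      rw [assoc, assoc, assoc, map_homOfLE_comp, hp₂', map_homOfLE_comp_assoc, reassoc_of% h.i_map,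
        hvr, comp_id, map_homOfLE_comp])
  simp only [assoc, map_homOfLE_comp] at e₃ e₄ e₅
  have e₃' := congrArg (· ≫ Φ.map (homOfLE (h₄.trans h₅).subset)) e₃
  simp only [assoc, map_homOfLE_comp] at e₃'
  have e₄' := congrArg (· ≫ Γ.map (homOfLE h₅.subset)) e₄
  simp only [assoc, map_homOfLE_comp] at e₄'
  refine ⟨{
    S := S
    S' := S₅
    ext := hQS
    ext' := (((h₁.trans h₂).trans h₃).trans h₄).trans h₅
    i := i₁ ≫ Φ.map (homOfLE (((h₂.trans h₃).trans h₄).trans h₅).subset)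
    p := p₂ ≫ Γ.map (homOfLE ((h₃.trans h₄).trans h₅).subset)
    i_map := by rw [assoc, map_homOfLE_comp, hi₁']
    p_map := by rw [assoc, map_homOfLE_comp, hp₂']
    map_i := by rw [reassoc_of% hi₁, map_homOfLE_comp]
    map_p := by rw [reassoc_of% hp₂, map_homOfLE_comp] }, rfl, hS.subset, e₃', e₄', e₅⟩

end

end CellularAlgebras

namespace CellularAlgebras

section

variable {K : Type u} [Category.{v} K] {N : Type v} {Γ Φ : Set N ⥤ K} {κ : Cardinal.{v}}
  [Fact κ.IsRegular] {v : Γ.obj Set.univ ⟶ Φ.obj Set.univ} {r : Φ.obj Set.univ ⟶ Γ.obj Set.univ}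

lemma SmallExt.iUnion (hκ : Cardinal.aleph0 < κ) {Q : Set N} {S : ULift.{v} ℕ → Set N}
    (hS : ∀ n, SmallExt κ Q (S n)) : SmallExt κ Q (⋃ n, S n) := by
  choose T hT h using hS
  refine ⟨⋃ n, T n, hasCardinalLT_iUnion _ ?_ hT, ?_⟩
  · rw [hasCardinalLT_iff_cardinal_mk_lt]
    simpa using hκ
  · rw [Set.union_iUnion]
    simp_rw [h]

lemma PartialRetract.exists_iUnion {κ : Cardinal.{v}} (hΓ : PreservesUnions Γ)
    (hΦ : PreservesUnions Φ) {Q : Set N} {σ : PartialRetract v r Q} (H : ULift.{v} ℕ → HalfRetract κ σ)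
    (hH : ∀ n, (H n).Rel (H ⟨n.down + 1⟩)) :
    ∃ (σ' : PartialRetract v r (⋃ n, (H n).S)) (hS : ∀ n, (H n).S' ⊆ ⋃ n, (H n).S), ∀ n,
      Γ.map (homOfLE ((H n).ext'.subset.trans (hS n))) ≫ σ'.i =
        (H n).i ≫ Φ.map (homOfLE (hS n)) ∧
      Φ.map (homOfLE ((H n).ext'.subset.trans (hS n))) ≫ σ'.p =
        (H n).p ≫ Γ.map (homOfLE (hS n)) := by
  have hsub (n) : (H n).S ⊆ ⋃ n, (H n).S := Set.subset_iUnion (fun n => (H n).S) n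
  have hsub' (n) : (H n).S' ⊆ ⋃ n, (H n).S := (hH n).le.trans (hsub ⟨n.down + 1⟩)
  have hmem : ∀ j ∈ ⋃ n, (H n).S, ∃ n, j ∈ (H n).S := fun j hj => by simpa using hj
  have key (n m : ℕ) (hnm : n ≤ m) : ∃ h : (H ⟨n⟩).S ⊆ (H ⟨m⟩).S,
      Γ.map (homOfLE h) ≫ (H ⟨m⟩).i ≫ Φ.map (homOfLE (hsub' ⟨m⟩)) =
        (H ⟨n⟩).i ≫ Φ.map (homOfLE (hsub' ⟨n⟩)) ∧
      Φ.map (homOfLE h) ≫ (H ⟨m⟩).p ≫ Γ.map (homOfLE (hsub' ⟨m⟩)) =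
        (H ⟨n⟩).p ≫ Γ.map (homOfLE (hsub' ⟨n⟩)) := by
    induction m, hnm using Nat.le_induction with
    | base => exact ⟨le_rfl, by simp, by simp⟩
    | succ m hm ih =>
      obtain ⟨h, h₁, h₂⟩ := ih
      have hr := hH ⟨m⟩
      have e₁ := hr.i_map
      have e₂ := hr.p_map
      dsimp only at e₁ e₂
      refine ⟨h.trans ((H ⟨m⟩).ext'.subset.trans hr.le), ?_, ?_⟩
      · rw [← h₁, ← map_homOfLE_comp Γ h ((H ⟨m⟩).ext'.subset.trans hr.le), assoc,
          ← reassoc_of% e₁, map_homOfLE_comp]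
      · rw [← h₂, ← map_homOfLE_comp Φ h ((H ⟨m⟩).ext'.subset.trans hr.le), assoc,
          ← reassoc_of% e₂, map_homOfLE_comp]
  have hmono : Monotone fun n => (H n).S := fun n m hnm => (key n.down m.down hnm).1
  obtain ⟨i, hi⟩ := hΓ.exists_desc hmono hsub hmem
    (fun n => (H n).i ≫ Φ.map (homOfLE (hsub' n))) fun n m h => (key n.down m.down h).2.1
  obtain ⟨p, hp⟩ := hΦ.exists_desc hmono hsub hmem
    (fun n => (H n).p ≫ Γ.map (homOfLE (hsub' n))) fun n m h => (key n.down m.down h).2.2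
  refine ⟨⟨i, p, ?_, ?_, ?_⟩, hsub', fun n => ⟨hi n, hp n⟩⟩
  · refine hΓ.hom_ext hmono hsub hmem fun n => ?_
    rw [reassoc_of% hi, ← map_homOfLE_comp Φ (hH n).le (hsub _), assoc, hp,
      reassoc_of% (hH n).i_p, map_homOfLE_comp, comp_id]
  · refine hΓ.hom_ext hmono hsub hmem fun n => ?_
    rw [reassoc_of% hi, map_homOfLE_comp, (H n).i_map, map_homOfLE_comp_assoc]
  · refine hΦ.hom_ext hmono hsub hmem fun n => ?_
    rw [reassoc_of% hp, map_homOfLE_comp, (H n).p_map, map_homOfLE_comp_assoc]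

lemma PartialRetract.exists_extension (hκ : Cardinal.aleph0 < κ) {W W' : MorphismProperty K}
    (hΓ : FatCellFunctor W κ Γ) (hΦ : FatCellFunctor W' κ Φ) (hvr : v ≫ r = 𝟙 _) {Q : Set N}
    (σ : PartialRetract v r Q) (z : N) :
    ∃ (S : Set N) (hS : SmallExt κ Q S) (σ' : PartialRetract v r S), z ∈ S ∧
      Γ.map (homOfLE hS.subset) ≫ σ'.i = σ.i ≫ Φ.map (homOfLE hS.subset) ∧
      Φ.map (homOfLE hS.subset) ≫ σ'.p = σ.p ≫ Γ.map (homOfLE hS.subset) := by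
  let h₀ : HalfRetract κ σ :=
    { S := Q
      S' := Q
      ext := .refl Q
      ext' := .refl Q
      i := σ.i
      p := σ.p
      i_map := σ.i_map
      p_map := σ.p_map
      map_i := by simp
      map_p := by simp }
  have hz (h : HalfRetract κ σ) : SmallExt κ h.S' (h.S' ∪ {z}) :=
    ⟨{z}, hasCardinalLT_of_finite _ _ (Fact.out : κ.IsRegular).aleph0_le, rfl⟩
  choose next hnext hrel using fun h : HalfRetract κ σ => h.exists_rel hΓ hΦ hvr (hz h)
  let H' (n : ℕ) : HalfRetract κ σ := n.rec h₀ fun _ => next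
  obtain ⟨σ', hS, h⟩ := PartialRetract.exists_iUnion hΓ.preservesUnions hΦ.preservesUnions
    (fun n : ULift.{v} ℕ => H' n.down) fun n => hrel (H' n.down)
  refine ⟨_, .iUnion hκ fun n => (H' n.down).ext, σ', ?_, h ⟨0⟩⟩
  refine Set.mem_iUnion.2 ⟨⟨1⟩, ?_⟩
  change z ∈ (next h₀).S
  rw [hnext]
  exact Or.inr rfl

end

end CellularAlgebras

namespace CellularAlgebras

section

variable {K : Type u} [Category.{v} K] {L : Type u'} [Category.{v} L] {U : L ⥤ K} {N : Type v}
  {G : Set N ⥤ L} {Φ : Set N ⥤ K} {κ : Cardinal.{v}} [Fact κ.IsRegular]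

lemma PreservesUnions.comp (hG : PreservesUnions G) (U : L ⥤ K)
    [PreservesColimitsOfSize.{v, v} U] : PreservesUnions (G ⋙ U) := fun D _ _ q s hs => by
  obtain ⟨h⟩ := hG D q s hs
  exact ⟨isColimitOfPreserves U h⟩

lemma FatCellFunctor.comp {W : MorphismProperty L} (hG : FatCellFunctor W κ G) (U : L ⥤ K)
    [PreservesColimitsOfSize.{v, v} U]
    (hU : ∀ A : L, IsCardinalPresentable A κ → IsCardinalPresentable (U.obj A) κ) :
    FatCellFunctor ⊤ κ (G ⋙ U) where
  preservesUnions := hG.preservesUnions.comp U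
  pushouts S T hT := by
    rw [top_inf_eq]
    exact map_presMaps_pushouts U hU
      (MorphismProperty.pushouts_monotone inf_le_right _ (hG.pushouts S T hT))

variable {Γ : Set N ⥤ K} {v : Γ.obj Set.univ ⟶ Φ.obj Set.univ}
  {r : Φ.obj Set.univ ⟶ Γ.obj Set.univ}

/-- A partial retraction together with a partial solution of a lifting problem. -/
structure PartialLift (G : Set N ⥤ L) (v : Γ.obj Set.univ ⟶ Φ.obj Set.univ)
    (r : Φ.obj Set.univ ⟶ Γ.obj Set.univ) {M M' : L} (x : G.obj ∅ ⟶ M)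
    (y : G.obj Set.univ ⟶ M') (p : M ⟶ M') where
  /-- the set where the retraction and the lift are defined -/
  S : Set N
  /-- the partial retraction -/
  σ : PartialRetract v r S
  /-- the partial lift -/
  l : G.obj S ⟶ M
  fac_left : G.map (homOfLE (Set.empty_subset _)) ≫ l = x
  fac_right : l ≫ p = G.map (homOfLE (Set.subset_univ _)) ≫ y

namespace PartialLift

variable {M M' : L} {y : G.obj Set.univ ⟶ M'} {p : M ⟶ M'} {x : G.obj ∅ ⟶ M}

/-- Extension of partial lifts. -/
structure Le (s t : PartialLift G v r x y p) : Prop where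
  le : s.S ⊆ t.S
  i : Γ.map (homOfLE le) ≫ t.σ.i = s.σ.i ≫ Φ.map (homOfLE le)
  p : Φ.map (homOfLE le) ≫ t.σ.p = s.σ.p ≫ Γ.map (homOfLE le)
  l : G.map (homOfLE le) ≫ t.l = s.l

instance : Preorder (PartialLift G v r x y p) where
  le := Le
  le_refl s := ⟨le_rfl, by simp, by simp, by simp⟩
  le_trans s t w h h' := ⟨h.le.trans h'.le,
    by rw [← map_homOfLE_comp _ h.le h'.le, assoc, h'.i, reassoc_of% h.i, map_homOfLE_comp],
    by rw [← map_homOfLE_comp _ h.le h'.le, assoc, h'.p, reassoc_of% h.p, map_homOfLE_comp],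
    by rw [← map_homOfLE_comp _ h.le h'.le, assoc, h'.l, h.l]⟩

lemma le_def {s t : PartialLift G v r x y p} : s ≤ t ↔ Le s t := Iff.rfl

lemma bddAbove_of_isChain (hG : PreservesUnions G)
    (hΓ : PreservesUnions Γ) (hΦ : PreservesUnions Φ) (c : Set (PartialLift G v r x y p))
    (hc : IsChain (· ≤ ·) c) (hc' : c.Nonempty) : BddAbove c := by
  have : Nonempty c := hc'.to_subtype
  have : IsDirectedOrder c := ⟨fun a b => by
    rcases hc.total a.2 b.2 with h | h
    · exact ⟨b, h, le_rfl⟩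
    · exact ⟨a, le_rfl, h⟩⟩
  have hmono : Monotone fun s : c => s.1.S := fun s t h => (le_def.1 h).le
  have hsub (s : c) : s.1.S ⊆ ⋃ s : c, s.1.S := Set.subset_iUnion (fun s : c => s.1.S) s
  have hmem : ∀ j ∈ ⋃ s : c, s.1.S, ∃ s : c, j ∈ s.1.S := fun j hj => Set.mem_iUnion.1 hj
  obtain ⟨i, hi⟩ := hΓ.exists_desc hmono hsub hmem (fun s => s.1.σ.i ≫ Φ.map (homOfLE (hsub s)))
    fun s t h => by rw [reassoc_of% (le_def.1 h).i, map_homOfLE_comp]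
  obtain ⟨q, hq⟩ := hΦ.exists_desc hmono hsub hmem
    (fun s => s.1.σ.p ≫ Γ.map (homOfLE (hsub s)))
    fun s t h => by rw [reassoc_of% (le_def.1 h).p, map_homOfLE_comp]
  obtain ⟨l, hl⟩ := hG.exists_desc hmono hsub hmem (fun s => s.1.l) fun s t h => (le_def.1 h).l
  refine ⟨⟨⋃ s : c, s.1.S, ⟨i, q, ?_, ?_, ?_⟩, l, ?_, ?_⟩, fun s hs =>
    ⟨hsub ⟨s, hs⟩, hi ⟨s, hs⟩, hq ⟨s, hs⟩, hl ⟨s, hs⟩⟩⟩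
  · refine hΓ.hom_ext hmono hsub hmem fun s => ?_
    rw [reassoc_of% hi, hq, reassoc_of% s.1.σ.i_p, comp_id]
  · refine hΓ.hom_ext hmono hsub hmem fun s => ?_
    rw [reassoc_of% hi, map_homOfLE_comp, s.1.σ.i_map, map_homOfLE_comp_assoc]
  · refine hΦ.hom_ext hmono hsub hmem fun s => ?_
    rw [reassoc_of% hq, map_homOfLE_comp, s.1.σ.p_map, map_homOfLE_comp_assoc]
  · obtain ⟨s⟩ := ‹Nonempty c›
    rw [← map_homOfLE_comp _ (Set.empty_subset s.1.S) (hsub s), assoc, hl, s.1.fac_left]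
  · refine hG.hom_ext hmono hsub hmem fun s => ?_
    rw [reassoc_of% hl, s.1.fac_right, map_homOfLE_comp_assoc]

end PartialLift

/-- A fat cell functor whose image is a retract of a fat cell functor on morphisms of `C` is built
from morphisms between presentable objects whose image is in `C`. -/
theorem rlp_llp_of_fatCellFunctor [HasColimitsOfSize.{v, v} K] [PreservesColimitsOfSize.{v, v} U]
    [IsCardinalLocallyPresentable L κ] (hκ : Cardinal.aleph0 < κ)
    (hU : ∀ A : L, IsCardinalPresentable A κ → IsCardinalPresentable (U.obj A) κ)
    {C : MorphismProperty K} [C.IsStableUnderRetracts] [C.IsStableUnderCobaseChange]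
    {W : MorphismProperty L} (hG : FatCellFunctor W κ G) (hΦ : FatCellFunctor C κ Φ)
    {v : (G ⋙ U).obj Set.univ ⟶ Φ.obj Set.univ} {r : Φ.obj Set.univ ⟶ (G ⋙ U).obj Set.univ}
    (hvr : v ≫ r = 𝟙 _) (σ₀ : PartialRetract v r ∅) :
    (presMaps L κ ⊓ C.inverseImage U).rlp.llp
      (G.map (homOfLE (Set.empty_subset _ : (∅ : Set N) ⊆ Set.univ))) := by
  intro M M' p hp
  refine ⟨fun {x y} sq => ?_⟩
  let s₀ : PartialLift G v r x y p := ⟨∅, σ₀, x, by simp, sq.w⟩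
  have : Nonempty (PartialLift G v r x y p) := ⟨s₀⟩
  obtain ⟨s, hs⟩ := zorn_le_nonempty fun c (hc : IsChain (· ≤ ·) c) =>
    PartialLift.bddAbove_of_isChain (v := v) (r := r) (x := x) (y := y) (p := p)
      hG.preservesUnions (hG.preservesUnions.comp U) hΦ.preservesUnions c hc
  have huniv : Set.univ ⊆ s.S := by
    intro z _
    obtain ⟨S, hS, σ', hz, hi, hq⟩ := s.σ.exists_extension hκ (hG.comp U hU) hΦ hvr z
    have hY := pushouts_inverseImage_of_retract U hU (C := C)
      (MorphismProperty.pushouts_monotone inf_le_right _ (hS.pushouts hG)) (hS.pushouts hΦ)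
      { i := Arrow.homMk s.σ.i σ'.i hi.symm
        r := Arrow.homMk s.σ.p σ'.p hq.symm
        retract := by
          ext
          · exact s.σ.i_p
          · exact σ'.i_p }
    have hlift : HasLiftingProperty (G.map (homOfLE hS.subset)) p := by
      obtain ⟨_, _, _, _, _, hx, hsq⟩ := hY
      exact (MorphismProperty.rlp _).llp.of_isPushout hsq
        (MorphismProperty.le_llp_rlp _ _ hx) _ hp
    have sq' : CommSq s.l (G.map (homOfLE hS.subset)) p
        (G.map (homOfLE (Set.subset_univ S)) ≫ y) :=
      ⟨by rw [s.fac_right, map_homOfLE_comp_assoc]⟩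
    let t : PartialLift G v r x y p := ⟨S, σ', sq'.lift, by
      rw [← map_homOfLE_comp _ (Set.empty_subset s.S) hS.subset, assoc, sq'.fac_left, s.fac_left],
      sq'.fac_right⟩
    have hst : s ≤ t := ⟨hS.subset, hi, hq, sq'.fac_left⟩
    exact (PartialLift.le_def.1 (hs hst)).le hz
  exact ⟨⟨{
    l := G.map (homOfLE huniv) ≫ s.l
    fac_left := by rw [map_homOfLE_comp_assoc, s.fac_left]
    fac_right := by
      rw [assoc, s.fac_right, map_homOfLE_comp_assoc]
      exact (congrArg (· ≫ y) (G.map_id _)).trans (id_comp y) }⟩⟩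

end

end CellularAlgebras

namespace CellularAlgebras

section

variable {K : Type u} [Category.{v} K] {L : Type u'} [Category.{v} L] {κ : Cardinal.{v}}
  [Fact κ.IsRegular]

lemma isIso_of_rlp_presMaps [IsCardinalLocallyPresentable K κ] {A B : K} {p : A ⟶ B}
    (hp : (presMaps K κ).rlp p) : IsIso p := by
  have := hasColimitsOfSizeShrink.{0, 0, v, v} K
  have hκ : Cardinal.aleph0 ≤ κ := (Fact.out : κ.IsRegular).aleph0_le
  obtain ⟨P, _, hP, hP'⟩ :=
    (IsCardinalLocallyPresentable.iff_exists_isStrongGenerator K κ).1 inferInstance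
  have : Mono p := by
    rw [hP.isSeparating.mono_iff]
    intro G hG g₁ g₂ h
    have : IsCardinalPresentable G κ := hP' _ hG
    have : ∀ k, IsCardinalPresentable ((pair G G).obj k) κ := by rintro ⟨_ | _⟩ <;> assumption
    have hGG : IsCardinalPresentable (G ⨿ G) κ :=
      isCardinalPresentable_of_isColimit _ (colimit.isColimit (pair G G)) κ
        (hasCardinalLT_of_finite _ _ hκ)
    have sq : CommSq (coprod.desc g₁ g₂) (coprod.desc (𝟙 G) (𝟙 G)) p (g₁ ≫ p) :=
      ⟨by ext <;> simp [h]⟩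
    have : HasLiftingProperty (coprod.desc (𝟙 G) (𝟙 G)) p := hp _ ⟨hGG, inferInstance⟩
    have e₁ := coprod.inl ≫= sq.fac_left
    have e₂ := coprod.inr ≫= sq.fac_left
    simp only [coprod.inl_desc_assoc, coprod.inr_desc_assoc, coprod.inl_desc, coprod.inr_desc,
      id_comp] at e₁ e₂
    exact e₁.symm.trans e₂
  refine hP.isIso_of_mono p fun G hG g => ?_
  have : IsCardinalPresentable G κ := hP' _ hG
  have h₀ : IsCardinalPresentable (⊥_ K) κ :=
    have : ∀ k, IsCardinalPresentable ((Functor.empty.{0} K).obj k) κ := by rintro ⟨⟨⟩⟩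
    isCardinalPresentable_of_isColimit _ (colimit.isColimit (Functor.empty.{0} K)) κ
      (hasCardinalLT_of_finite _ _ hκ)
  have : HasLiftingProperty (initial.to G) p := hp _ ⟨h₀, inferInstance⟩
  have sq : CommSq (initial.to A) (initial.to G) p g := ⟨Subsingleton.elim _ _⟩
  exact ⟨sq.lift, sq.fac_right⟩

instance : (presMaps K κ).RespectsIso :=
  MorphismProperty.RespectsIso.of_respects_arrow_iso _ fun f g e hf => by
    have : IsCardinalPresentable (Arrow.leftFunc.obj f) κ := hf.1
    have : IsCardinalPresentable (Arrow.rightFunc.obj f) κ := hf.2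
    exact ⟨isCardinalPresentable_of_iso (Arrow.leftFunc.mapIso e) κ,
      isCardinalPresentable_of_iso (Arrow.rightFunc.mapIso e) κ⟩

/-- In a locally presentable category, every morphism is a fat cell complex. -/
lemma exists_isFat {κ₀ : Cardinal.{v}} [Fact κ₀.IsRegular] (hκ : κ₀ < κ)
    [IsCardinalLocallyPresentable K κ₀] {A B : K} (f : A ⟶ B) : IsFat ⊤ κ f := by
  obtain ⟨Z, i, p, ⟨N, Φ, hΦ, α, β, hi⟩, hp, rfl⟩ := exists_isFat_rlp hκ (le_refl (presMaps K κ₀)) f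
  have := isIso_of_rlp_presMaps hp
  refine ⟨N, Φ, ⟨hΦ.1, fun S T hT => MorphismProperty.pushouts_monotone
    (inf_le_inf_right _ le_top) _ (hΦ.2 S T hT)⟩, α, β ≪≫ asIso p, ?_⟩
  simp [← hi]

/-- The preimage functor between power sets. -/
def preimageFunctor {N M : Type v} (g : N → M) : Set M ⥤ Set N :=
  Monotone.functor (f := fun S => g ⁻¹' S) fun _ _ h => Set.preimage_mono h

lemma FatCellFunctor.preimage {N M : Type v} {Φ : Set N ⥤ K} {W : MorphismProperty K}
    (hΦ : FatCellFunctor W κ Φ) {g : N → M} (hg : Function.Injective g) :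
    FatCellFunctor W κ (preimageFunctor g ⋙ Φ) where
  preservesUnions D _ _ q s hs := by
    obtain ⟨h⟩ := hΦ.1 D (q ⋙ preimageFunctor g) ((preimageFunctor g).mapCocone s)
      fun j hj => hs _ hj
    exact ⟨h⟩
  pushouts S T hT := hΦ.pushouts (g ⁻¹' S) (g ⁻¹' T)
    (hT.of_injective (fun x : g ⁻¹' T => (⟨g x, x.2⟩ : T))
      fun x y h => Subtype.ext (hg (congrArg Subtype.val h)))

lemma rlp_llp_of_retract [HasColimitsOfSize.{v, v} K] {U : L ⥤ K}
    [PreservesColimitsOfSize.{v, v} U] [IsCardinalLocallyPresentable L κ]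
    (hκ : Cardinal.aleph0 < κ)
    (hU : ∀ A : L, IsCardinalPresentable A κ → IsCardinalPresentable (U.obj A) κ)
    {C : MorphismProperty K} [C.IsStableUnderRetracts] [C.IsStableUnderCobaseChange]
    {A B : L} {f : A ⟶ B} {Z : K} {i : U.obj A ⟶ Z} {l : U.obj B ⟶ Z} {p : Z ⟶ U.obj B}
    (hf : IsFat ⊤ κ f) (hi : IsFat C κ i) (h₁ : U.map f ≫ l = i) (h₂ : i ≫ p = U.map f)
    (h₃ : l ≫ p = 𝟙 _) :
    (presMaps L κ ⊓ C.inverseImage U).rlp.llp f := by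
  obtain ⟨N, G, hG, α, β, hf⟩ := hf
  obtain ⟨N', Φ, hΦ, α', β', hi⟩ := hi
  have hG' := hG.preimage (g := (Sum.inl : N → N ⊕ N')) Sum.inl_injective
  have hΦ' := hΦ.preimage (g := (Sum.inr : N' → N ⊕ N')) Sum.inr_injective
  have e₁ : G.map (homOfLE (Set.empty_subset _)) = α.inv ≫ f ≫ β.inv := by simp [← hf]
  have e₂ : Φ.map (homOfLE (Set.empty_subset _)) = α'.inv ≫ i ≫ β'.inv := by simp [← hi]
  have key := rlp_llp_of_fatCellFunctor (U := U) hκ hU hG' hΦ'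
    (v := U.map β.hom ≫ l ≫ β'.inv) (r := β'.hom ≫ p ≫ U.map β.inv)
    ?_ ⟨U.map α.inv ≫ α'.hom, α'.inv ≫ U.map α.hom, ?_, ?_, ?_⟩
  · have key : (presMaps L κ ⊓ C.inverseImage U).rlp.llp
        (G.map (homOfLE (Set.empty_subset Set.univ))) := key
    rw [e₁] at key
    exact (MorphismProperty.arrow_mk_iso_iff _ (Arrow.isoMk α β.symm (by simp))).2 key
  · refine Eq.trans ?_ (U.map_id (G.obj Set.univ))
    change (U.map β.hom ≫ l ≫ β'.inv) ≫ β'.hom ≫ p ≫ U.map β.inv = _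
    simp [reassoc_of% h₃]
  · refine Eq.trans ?_ (U.map_id (G.obj ∅))
    change (U.map α.inv ≫ α'.hom) ≫ α'.inv ≫ U.map α.hom = _
    simp
  · change (U.map α.inv ≫ α'.hom) ≫ Φ.map (homOfLE (Set.empty_subset _)) =
      U.map (G.map (homOfLE (Set.empty_subset _))) ≫ U.map β.hom ≫ l ≫ β'.inv
    rw [e₁, e₂, ← U.map_comp_assoc]
    simp [← h₁]
  · change (α'.inv ≫ U.map α.hom) ≫ U.map (G.map (homOfLE (Set.empty_subset _))) =
      Φ.map (homOfLE (Set.empty_subset _)) ≫ β'.hom ≫ p ≫ U.map β.inv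
    rw [e₁, e₂, assoc, ← U.map_comp]
    simp [reassoc_of% h₂]

/-- Morphisms whose image under a cocontinuous functor is a cofibration are cofibrantly generated
by the ones between presentable objects. -/
theorem rlp_llp_of_map {κ₀ : Cardinal.{v}} [Fact κ₀.IsRegular] (hκ : κ₀ < κ) {U : L ⥤ K}
    [PreservesColimitsOfSize.{v, v} U] [IsCardinalLocallyPresentable K κ₀]
    [IsCardinalLocallyPresentable L κ₀]
    (hU : ∀ A : L, IsCardinalPresentable A κ → IsCardinalPresentable (U.obj A) κ)
    {X : MorphismProperty K} [X.RespectsIso] (hX : X ≤ presMaps K κ₀) {A B : L} {f : A ⟶ B}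
    (hf : X.rlp.llp (U.map f)) :
    (presMaps L κ ⊓ X.rlp.llp.inverseImage U).rlp.llp f := by
  have := IsCardinalLocallyPresentable.of_le L hκ.le
  obtain ⟨Z, i, p, hi, hp, h⟩ := exists_isFat_rlp hκ hX (U.map f)
  have sq : CommSq i (U.map f) p (𝟙 _) := ⟨by rw [h, comp_id]⟩
  have := hf p hp
  exact rlp_llp_of_retract (lt_of_le_of_lt (Fact.out : κ₀.IsRegular).aleph0_le hκ) hU
    (exists_isFat hκ f) hi sq.fac_left h sq.fac_right

end

end CellularAlgebras

namespace CellularAlgebras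

section

variable {K : Type u} [Category.{v} K] {L : Type u'} [Category.{v} L] {κ : Cardinal.{v}}
  [Fact κ.IsRegular]

lemma isCardinalDirected_iff (P : Type v) [Preorder P] :
    CellularPaper.IsCardinalDirected P κ ↔ IsCardinalFiltered P κ := by
  constructor
  · intro h
    refine isCardinalFiltered_preorder P κ fun I s hI => ?_
    obtain ⟨p, hp⟩ := h (Set.range s) (Cardinal.mk_range_le.trans_lt hI)
    exact ⟨p, fun k => hp _ ⟨k, rfl⟩⟩
  · intro h S hS
    have hS' : HasCardinalLT S κ := (hasCardinalLT_iff_cardinal_mk_lt _ _).2 hS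
    exact ⟨IsCardinalFiltered.max (fun s : S => (s : P)) hS', fun s hs =>
      leOfHom (IsCardinalFiltered.toMax (fun s : S => (s : P)) hS' ⟨s, hs⟩)⟩

lemma isCardinalPresentable_iff_paper (A : K) :
    CellularPaper.IsCardinalPresentable κ A ↔ IsCardinalPresentable A κ := by
  constructor
  · intro h
    refine ⟨fun J _ _ => ?_⟩
    obtain ⟨α, _, _, F, _⟩ := IsCardinalFiltered.exists_cardinal_directed J κ
    have : PreservesColimitsOfShape α (coyoneda.obj (op A)) :=
      (h α inferInstance ((isCardinalDirected_iff α).2 inferInstance)).some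
    refine ⟨fun {D} => ⟨fun {c} hc => ⟨?_⟩⟩⟩
    have h₁ : IsColimit (c.whisker F) := (Functor.Final.isColimitWhiskerEquiv F c).symm hc
    exact Functor.Final.isColimitWhiskerEquiv F ((coyoneda.obj (op A)).mapCocone c)
      (isColimitOfPreserves (coyoneda.obj (op A)) h₁)
  · intro h P _ hP
    have := (isCardinalDirected_iff P).1 hP
    exact ⟨preservesColimitsOfShape_of_isCardinalPresentable A κ P⟩

lemma isCardinalLocallyPresentable_of_paper {κ : Cardinal.{v}}
    (h : CellularPaper.IsLocallyPresentable κ K) :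
    ∃ _ : Fact κ.IsRegular, IsCardinalLocallyPresentable K κ := by
  have hκ : Fact κ.IsRegular := ⟨h.regular⟩
  refine ⟨hκ, ?_⟩
  obtain ⟨ι, G, hG, hG'⟩ := h.generators
  have := h.hasColimits
  have hP : (ObjectProperty.ofObj G).isoClosure.IsCardinalFilteredGenerator κ := by
    refine ⟨?_, fun X => ?_⟩
    · rw [ObjectProperty.isoClosure_le_iff]
      rintro _ ⟨i⟩
      exact (isCardinalPresentable_iff_paper _).1 (hG i)
    · obtain ⟨P, _, F, c, hc, hP, ⟨e⟩, hF⟩ := hG' X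
      refine ⟨P, inferInstance, (isCardinalDirected_iff P).1 hP,
        ObjectProperty.prop_of_iso _ e
          ⟨{ diag := F, ι := c.ι, isColimit := hc, prop_diag_obj := ?_ }⟩⟩
      intro p
      obtain ⟨i, ⟨e'⟩⟩ := hF p
      exact ⟨G i, ⟨i⟩, ⟨e'⟩⟩
  have := hP.hasCardinalFilteredGenerator
  constructor

lemma isLocallyPresentable_paper [IsCardinalLocallyPresentable K κ] :
    CellularPaper.IsLocallyPresentable κ K where
  regular := Fact.out
  hasColimits := inferInstance
  generators := by
    obtain ⟨Q, hQ, hQ₁, hQ₂⟩ :=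
      ObjectProperty.EssentiallySmall.exists_small_le.{v} (isCardinalPresentable K κ)
    have : Small.{v} (Subtype Q) := hQ
    refine ⟨Shrink.{v} (Subtype Q), fun i => ((equivShrink _).symm i).1, fun i =>
      (isCardinalPresentable_iff_paper _).2 (hQ₁ _ ((equivShrink _).symm i).2), fun X => ?_⟩
    obtain ⟨P, _, hP, F, c, hc, hF, rfl⟩ := exists_presentation κ X
    refine ⟨P, inferInstance, F, c, hc, (isCardinalDirected_iff P).2 hP, ⟨Iso.refl _⟩, fun p => ?_⟩
    obtain ⟨A, hA, ⟨e⟩⟩ := hQ₂ _ (hF p)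
    exact ⟨equivShrink _ ⟨A, hA⟩, ⟨e ≪≫ eqToIso (by simp)⟩⟩

lemma isStrongGenerator_strictMap {F : K ⥤ L} {U : L ⥤ K} (adj : F ⊣ U) [U.Faithful]
    [U.ReflectsIsomorphisms] {P : ObjectProperty K} (hP : P.IsStrongGenerator) :
    (P.strictMap F).IsStrongGenerator := by
  have := adj.rightAdjoint_preservesLimits
  rw [ObjectProperty.isStrongGenerator_iff]
  refine ⟨fun X Y f g h => U.map_injective (hP.isSeparating _ _ fun G hG k => ?_),
    fun X Y i _ hi => ?_⟩
  · obtain ⟨k, rfl⟩ := (adj.homEquiv _ _).surjective k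
    rw [← adj.homEquiv_naturality_right, ← adj.homEquiv_naturality_right, h _ ⟨G, hG⟩]
  · have : IsIso (U.map i) := hP.isIso_of_mono _ fun G hG k => by
      obtain ⟨k, rfl⟩ := (adj.homEquiv _ _).surjective k
      obtain ⟨l, rfl⟩ := hi _ ⟨G, hG⟩ k
      exact ⟨adj.homEquiv _ _ l, (adj.homEquiv_naturality_right _ _).symm⟩
    exact isIso_of_reflects_iso i U

lemma isCardinalLocallyPresentable_of_adjunction {F : K ⥤ L} {U : L ⥤ K} (adj : F ⊣ U)
    [U.Faithful] [U.ReflectsIsomorphisms] [HasColimitsOfSize.{v, v} L]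
    [PreservesColimitsOfSize.{v, v} U] {P : ObjectProperty K} [ObjectProperty.Small.{v} P]
    (hP : P.IsStrongGenerator) (hP' : P ≤ isCardinalPresentable K κ) :
    IsCardinalLocallyPresentable L κ := by
  rw [IsCardinalLocallyPresentable.iff_exists_isStrongGenerator]
  refine ⟨P.strictMap F, inferInstance, isStrongGenerator_strictMap adj hP, ?_⟩
  rintro _ ⟨X, hX⟩
  have : IsCardinalPresentable X κ := hP' _ hX
  exact adj.isCardinalPresentable_leftAdjoint_obj κ X

lemma isCardinalPresentable_obj_of_adjunction {F : K ⥤ L} {U : L ⥤ K} (adj : F ⊣ U)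
    [U.Faithful] [U.ReflectsIsomorphisms] [HasColimitsOfSize.{v, v} L]
    [PreservesColimitsOfSize.{v, v} U] {P : ObjectProperty K} [ObjectProperty.Small.{v} P]
    (hP : P.IsStrongGenerator) (hP' : P ≤ isCardinalPresentable K κ)
    (hUF : ∀ X, P X → IsCardinalPresentable (U.obj (F.obj X)) κ) (A : L)
    [hA : IsCardinalPresentable A κ] : IsCardinalPresentable (U.obj A) κ := by
  have hS : P.strictMap F ≤ isCardinalPresentable L κ := by
    rintro _ ⟨X, hX⟩
    have : IsCardinalPresentable X κ := hP' _ hX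
    exact adj.isCardinalPresentable_leftAdjoint_obj κ X
  have h := IsStrongGenerator.colimitsCardinalClosure_eq_isCardinalPresentable
    (isStrongGenerator_strictMap adj hP) hS
  have hA' : (P.strictMap F).colimitsCardinalClosure κ A := by
    rw [← h]; exact hA
  refine ObjectProperty.colimitsCardinalClosure_le.{v}
    (Q := (isCardinalPresentable K κ).inverseImage U) _ κ ?_ ?_ _ hA'
  · intro J _ (hJ : HasCardinalLT.{v, v} (Arrow J) κ)
    have : (isCardinalPresentable K κ).IsClosedUnderColimitsOfShape J :=
      isClosedUnderColimitsOfShape_isCardinalPresentable.{v, v, v, v, u} K hJ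
    infer_instance
  · rintro _ ⟨X, hX⟩
    exact hUF X hX

lemma exists_forall_isCardinalPresentable [IsCardinalLocallyPresentable K κ] {ι : Type v}
    (G : ι → K) : ∃ (κ' : Cardinal.{v}) (_ : Fact κ'.IsRegular), κ ≤ κ' ∧
      ∀ i, IsCardinalPresentable (G i) κ' := by
  have : ∀ i, ∃ (κ' : Cardinal.{v}) (_ : Fact κ'.IsRegular), IsCardinalPresentable (G i) κ' := by
    intro i
    have : IsLocallyPresentable.{v} K := ⟨κ, inferInstance, inferInstance⟩
    have : IsPresentable.{v} (G i) := inferInstance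
    exact Functor.IsAccessible.exists_cardinal
  choose k hk hk' using this
  obtain ⟨κ', h₁, h₂⟩ := HasCardinalLT.exists_regular_cardinal_forall.{v}
      (Sum.elim (fun i : ι => (k i).ord.ToType) (fun (_ : Unit) => κ.ord.ToType))
  have : Fact κ'.IsRegular := ⟨h₁⟩
  refine ⟨κ', ⟨h₁⟩, le_of_lt (by simpa [hasCardinalLT_iff_cardinal_mk_lt] using h₂ (Sum.inr ⟨⟩)),
    fun i => ?_⟩
  have := hk' i
  exact isCardinalPresentable_of_le (G i) (κ := k i)
    (le_of_lt (by simpa [hasCardinalLT_iff_cardinal_mk_lt] using h₂ (Sum.inl i)))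

end

end CellularAlgebras

namespace CellularAlgebras

section

variable {K : Type u} [Category.{v} K] {L : Type u'} [Category.{v} L]

lemma ofFamily_respectsIso {ι : Type v} {a b : ι → K} (s : ∀ i, a i ⟶ b i) :
    (CellularPaper.ofFamily s).RespectsIso :=
  MorphismProperty.RespectsIso.of_respects_arrow_iso _ fun _ _ e ⟨i, ⟨e'⟩⟩ =>
    ⟨i, ⟨e.symm ≪≫ e'⟩⟩

lemma exists_ofFamily_eq_isoClosure (Y : MorphismProperty K) [MorphismProperty.IsSmall.{v} Y] :
    ∃ (ι : Type v) (a b : ι → K) (s : ∀ i, a i ⟶ b i),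
      CellularPaper.ofFamily s = Y.isoClosure := by
  have : Small.{v} Y.toSet := MorphismProperty.IsSmall.small_toSet
  let g (i : Shrink.{v} Y.toSet) : Arrow K := ((equivShrink Y.toSet).symm i).1
  refine ⟨Shrink.{v} Y.toSet, fun i => (g i).left, fun i => (g i).right, fun i => (g i).hom, ?_⟩
  ext A B f
  constructor
  · rintro ⟨i, ⟨e⟩⟩
    exact ⟨_, _, (g i).hom, ((equivShrink Y.toSet).symm i).2, ⟨e.symm⟩⟩
  · rintro ⟨A', B', f', hf', ⟨e⟩⟩
    have h : g (equivShrink Y.toSet ⟨Arrow.mk f', hf'⟩) = Arrow.mk f' := by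
      simp [g]
    exact ⟨equivShrink Y.toSet ⟨Arrow.mk f', hf'⟩, ⟨e.symm ≪≫ eqToIso h.symm⟩⟩

lemma le_cofClosure (X : MorphismProperty K) : X ≤ CellularPaper.cofClosure X := by
  intro A B f hf
  have hf' : CellularPaper.Po X f := ⟨A, B, f, 𝟙 A, 𝟙 B, hf, IsPushout.of_vert_isIso ⟨by simp⟩⟩
  obtain ⟨J, _, _, _, _, ⟨E⟩⟩ := (MorphismProperty.transfiniteCompositions_iff.{v} _ f).1
    (MorphismProperty.le_transfiniteCompositions.{v} _ f hf')
  exact ⟨A, B, f, isTransfiniteCompositionOf_of_transfiniteCompositionOfShape E,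
    𝟙 A, 𝟙 B, 𝟙 A, 𝟙 B, by simp, by simp, by simp, by simp⟩

lemma isRetractOf_of_fac {A B Z : K} {f : A ⟶ B} {i : A ⟶ Z} {p : Z ⟶ B} (h : i ≫ p = f)
    [HasLiftingProperty f p] : CellularPaper.IsRetractOf f i := by
  have sq : CommSq i f p (𝟙 _) := ⟨by rw [h, comp_id]⟩
  exact ⟨𝟙 _, sq.lift, 𝟙 _, p, by simp, by simp [h], by simp, by simp⟩

lemma isTransfiniteCompositionOf_of_isFat {W Z : MorphismProperty K} {κ : Cardinal.{v}}
    [Fact κ.IsRegular] (hZ : (W ⊓ presMaps K κ).pushouts ≤ Z) {A B : K} {i : A ⟶ B}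
    (hi : IsFat W κ i) : CellularPaper.IsTransfiniteCompositionOf.{v} Z i := by
  obtain ⟨N, Φ, hΦ, α, β, rfl⟩ := hi
  obtain ⟨J, _, _, _, _, F, c, hc, eA, eB, h₁, h₂, h₃⟩ :=
    isTransfiniteCompositionOf_of_preservesUnions (Z := Z) hΦ.preservesUnions fun S j _ =>
      hZ _ (hΦ.pushouts S {j}
        (hasCardinalLT_of_finite _ _ (Fact.out : κ.IsRegular).aleph0_le))
  exact ⟨J, _, _, _, inferInstance, F, c, hc, α ≪≫ eA, eB ≪≫ β, h₁, h₂, by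
    rw [← h₃]; simp⟩

theorem isCofibrantlyGenerated_rlp_llp {κ₀ κ : Cardinal.{v}} [Fact κ₀.IsRegular]
    [Fact κ.IsRegular] (hκ : κ₀ < κ) [IsCardinalLocallyPresentable K κ₀] {X : MorphismProperty K}
    [X.RespectsIso] (hX : X ≤ presMaps K κ₀) :
    CellularPaper.IsCofibrantlyGenerated X.rlp.llp := by
  have := IsCardinalLocallyPresentable.of_le K hκ.le
  obtain ⟨Y, _, h, h'⟩ := exists_small_of_le_presMaps κ
    (X := X.rlp.llp ⊓ presMaps K κ) inf_le_right
  obtain ⟨ι, a, b, s, hs⟩ := exists_ofFamily_eq_isoClosure Y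
  refine ⟨ι, a, b, s, le_antisymm (fun A B f hf => ?_) ?_⟩
  · obtain ⟨Z, i, p, hi, hp, hip⟩ := exists_isFat_rlp hκ hX f
    have := hf p hp
    refine ⟨_, _, i, isTransfiniteCompositionOf_of_isFat ?_ hi, isRetractOf_of_fac hip⟩
    rintro A B g ⟨A', B', f, u, w, hf, sq⟩
    exact ⟨A', B', f, u, w, hs ▸ h' _ hf, sq.flip⟩
  · refine (cofClosure_le_rlp_llp _).trans ?_
    have := ofFamily_respectsIso s
    refine MorphismProperty.antitone_llp ?_
    rw [← MorphismProperty.le_llp_iff_le_rlp, hs, MorphismProperty.isoClosure_le_iff]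
    exact h.trans inf_le_left

lemma isCellular_inverseImage {U : L ⥤ K} [PreservesColimitsOfSize.{v, v} U]
    {C : MorphismProperty K} (hC : CellularPaper.IsCellular C) :
    CellularPaper.IsCellular (C.inverseImage U) where
  isos f _ := hC.isos _ inferInstance
  pushout sq hf := by
    have := preservesColimitsOfSize_shrink.{0, v, 0, v} U
    exact hC.pushout (sq.map U) hf
  transfinite := by
    rintro A B f ⟨J, _, _, _, _, F, c, hc, eA, eB, h₁, h₂, rfl⟩
    refine hC.transfinite _ ⟨J, inferInstance, inferInstance, inferInstance, inferInstance,
      F ⋙ U, _, isColimitOfPreserves U hc, U.mapIso eA, U.mapIso eB, h₁, fun j hj => ?_,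
      by simp⟩
    obtain ⟨h⟩ := h₂ j hj
    exact ⟨isColimitOfPreserves U h⟩

lemma retracts_inverseImage_le {U : L ⥤ K} {C : MorphismProperty K}
    (hC : CellularPaper.retracts C ≤ C) :
    CellularPaper.retracts (C.inverseImage U) ≤ C.inverseImage U := by
  rintro A B f ⟨X, Y, g, hg, u, w, r, s, h₁, h₂, h₃, h₄⟩
  refine hC _ ⟨_, _, U.map g, hg, U.map u, U.map w, U.map r, U.map s, ?_, ?_, ?_, ?_⟩ <;>
    simp only [← U.map_comp, *, U.map_id]

theorem isCombinatorial_inverseImage {C : MorphismProperty K}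
    (hC : CellularPaper.IsCombinatorial K C) {F : K ⥤ L} {U : L ⥤ K} (adj : F ⊣ U)
    [U.Faithful] [U.ReflectsIsomorphisms] [HasColimitsOfSize.{v, v} L]
    [PreservesColimitsOfSize.{v, v} U] :
    CellularPaper.IsCombinatorial L (C.inverseImage U) := by
  obtain ⟨κ₁, h⟩ := hC.locallyPresentable
  obtain ⟨_, _⟩ := isCardinalLocallyPresentable_of_paper h
  obtain ⟨P, _, hP, hPκ₁⟩ :=
    (IsCardinalLocallyPresentable.iff_exists_isStrongGenerator K κ₁).1 inferInstance
  obtain ⟨ι, a, b, s, hs⟩ := hC.cofibrantlyGenerated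
  have : Small.{v} (Subtype P) := ‹ObjectProperty.Small.{v} P›
  obtain ⟨κ₀, _, hκ₁, hκ₀⟩ := exists_forall_isCardinalPresentable (κ := κ₁)
    (Sum.elim (Sum.elim a b) fun i : Shrink.{v} (Subtype P) =>
      U.obj (F.obj ((equivShrink (Subtype P)).symm i).1))
  have hUF (X : K) (hX : P X) : IsCardinalPresentable (U.obj (F.obj X)) κ₀ := by
    simpa using hκ₀ (Sum.inr (equivShrink (Subtype P) ⟨X, hX⟩))
  have hPκ₀ := hPκ₁.trans (isCardinalPresentable_monotone K hκ₁)
  have := IsCardinalLocallyPresentable.of_le K hκ₁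
  have := isCardinalLocallyPresentable_of_adjunction adj hP hPκ₀
  let X := CellularPaper.ofFamily s
  have : X.RespectsIso := ofFamily_respectsIso s
  have hX : X ≤ presMaps K κ₀ := by
    rintro A B f ⟨i, ⟨e⟩⟩
    exact (MorphismProperty.arrow_mk_iso_iff (presMaps K κ₀) e).2
      ⟨hκ₀ (Sum.inl (Sum.inl i)), hκ₀ (Sum.inl (Sum.inr i))⟩
  have hXC : X ≤ C := by
    rw [hs]
    exact le_cofClosure X
  have hC' : C = X.rlp.llp := le_antisymm (hs.le.trans (cofClosure_le_rlp_llp X))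
    (rlp_llp_le_of_isCellular κ₀ hC.cellular hC.retractClosed hX hXC)
  let κ := Order.succ κ₀
  have hκ : κ₀ < κ := Order.lt_succ κ₀
  have : Fact κ.IsRegular := ⟨Cardinal.isRegular_succ (Fact.out : κ₀.IsRegular).aleph0_le⟩
  let κ' := Order.succ κ
  have : Fact κ'.IsRegular := ⟨Cardinal.isRegular_succ (Fact.out : κ.IsRegular).aleph0_le⟩
  have := IsCardinalLocallyPresentable.of_le L hκ.le
  let Y : MorphismProperty L := presMaps L κ ⊓ C.inverseImage U
  have hcell := isCellular_inverseImage (U := U) hC.cellular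
  have hret := retracts_inverseImage_le (U := U) hC.retractClosed
  have := hcell.respectsIso
  have : Y.RespectsIso := inferInstance
  have hY : C.inverseImage U = Y.rlp.llp := by
    refine le_antisymm (fun A B f hf => ?_)
      (rlp_llp_le_of_isCellular κ hcell hret inf_le_left inf_le_right)
    simp only [Y, hC']
    refine rlp_llp_of_map hκ (fun A _ => ?_) hX ?_
    · have hPκ := hPκ₀.trans (isCardinalPresentable_monotone K hκ.le)
      exact isCardinalPresentable_obj_of_adjunction adj hP hPκ (fun X hX =>
        have := hUF X hX; isCardinalPresentable_of_le _ hκ.le) A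
    · rw [← hC']; exact hf
  refine ⟨⟨κ, isLocallyPresentable_paper⟩, hcell, hret, ?_⟩
  rw [hY]
  exact isCofibrantlyGenerated_rlp_llp (Order.lt_succ κ) inf_le_left

end

end CellularAlgebras

namespace CellularPaper

/-- if `T` is a colimit-preserving monad on a combinatorial category `K`,
then the category of `T`-algebras, with `f` a cofibration iff `Uf` is one, is
combinatorial, and the forgetful functor preserves colimits. -/
theorem monad_algebras_combinatorial {K : Type u} [Category.{v} K]
    (C : MorphismProperty K) (h : IsCombinatorial K C)
    (T : Monad K) [PreservesColimits (T : K ⥤ K)] :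
    Nonempty (PreservesColimits (Monad.forget T)) ∧
    IsCombinatorial T.Algebra (fun _ _ f => C ((Monad.forget T).map f)) := by
  obtain ⟨κ, hκ⟩ := h.locallyPresentable
  have := hκ.hasColimits
  have : HasColimits T.Algebra :=
    ⟨fun J _ => ⟨fun D => Monad.forget_creates_colimits_of_monad_preserves D⟩⟩
  exact ⟨⟨inferInstance⟩, CellularAlgebras.isCombinatorial_inverseImage h T.adj⟩

end CellularPaper
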